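/- The Apéry-like series of weight 5 evaluates as: ∑_{k=1}^∞ 4^k H_k / (k^4 · C(2k,k)) = −(31/2)ζ(5) + 3ζ(2)ζ(3) + 16 Li_5(1/2) + 2 ln(2) ζ(4) + (16/3) ln^3(2) ζ(2) − (2/15) ln^5(2). -/

import Mathlib

open Real

/-- Riemann zeta value at a positive integer `m > 1`, as the series `∑ 1/n^m`. -/
noncomputable def zetaVal (m : ℕ) : ℝ := ∑' n : ℕ, 1 / (n + 1 : ℝ) ^ m

/-- Polylogarithm `Li_m(z) = ∑_{k≥1} z^k / k^m`. -/
noncomputable def polyLog (m : ℕ) (z : ℝ) : ℝ := ∑' k : ℕ, z ^ (k + 1) / (k + 1 : ℝ) ^ m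

/-- Generalized harmonic number `H_k^{(m)} = ∑_{n=1}^k 1/n^m`. -/
noncomputable def genHarmonic (k m : ℕ) : ℝ := ∑ n ∈ Finset.range k, 1 / (n + 1 : ℝ) ^ m

set_option linter.unusedSimpArgs false

open Real

inductive Lt where
  | a : Lt
  | b : Lt
  | c : Lt

namespace AZ
open Lt Filter Topology

noncomputable def co : List Lt → ℕ → ℝ
  | [], n => if n = 0 then 1 else 0
  | Lt.a :: w, n => co w n / n
  | Lt.b :: w, n => (-1) ^ (n + 1) * (∑ k ∈ Finset.range n, (-1) ^ k * co w k) / n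
  | Lt.c :: w, n => (∑ k ∈ Finset.range n, co w k) / n

lemma co_zero (x : Lt) (w : List Lt) : co (x :: w) 0 = 0 := by
  cases x <;> simp [co]

lemma co_zero' {w : List Lt} (h : w ≠ []) : co w 0 = 0 := by
  cases w with
  | nil => exact absurd rfl h
  | cons x w => exact co_zero x w

lemma div_nat_le_one {x : ℝ} {n : ℕ} (h : |x| ≤ n) : |x / n| ≤ 1 := by
  rw [abs_div, Nat.abs_cast]
  exact div_le_one_of_le₀ h (Nat.cast_nonneg n)

lemma abs_co_le_one (w : List Lt) (n : ℕ) : |co w n| ≤ 1 := by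
  induction w generalizing n with
  | nil => simp only [co]; split_ifs <;> simp
  | cons x w ih =>
    cases x with
    | a =>
      simp only [co]
      rcases Nat.eq_zero_or_pos n with h | h
      · subst h; simp
      · apply div_nat_le_one
        exact (ih n).trans (by exact_mod_cast h)
    | b =>
      simp only [co]
      apply div_nat_le_one
      rw [abs_mul, abs_pow, abs_neg, abs_one, one_pow, one_mul]
      refine (Finset.abs_sum_le_sum_abs _ _).trans ?_
      calc _ ≤ ∑ k ∈ Finset.range n, (1 : ℝ) := Finset.sum_le_sum (fun k _ => by
            rw [abs_mul, abs_pow, abs_neg, abs_one, one_pow, one_mul]; exact ih k)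
        _ = n := by simp
    | c =>
      simp only [co]
      apply div_nat_le_one
      refine (Finset.abs_sum_le_sum_abs _ _).trans ?_
      calc _ ≤ ∑ k ∈ Finset.range n, (1 : ℝ) := Finset.sum_le_sum (fun k _ => ih k)
        _ = n := by simp

noncomputable def I (w : List Lt) (t : ℝ) : ℝ := ∑' n, co w n * t ^ n

noncomputable def om : Lt → ℝ → ℝ
  | Lt.a, t => 1 / t
  | Lt.b, t => 1 / (1 + t)
  | Lt.c, t => 1 / (1 - t)

lemma summable_pow_of_bdd {f : ℕ → ℝ} (hf : ∀ n, |f n| ≤ 1) {t : ℝ} (ht : |t| < 1) :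
    Summable (fun n => f n * t ^ n) := by
  refine Summable.of_norm_bounded (g := fun n => |t| ^ n) (summable_geometric_of_lt_one (abs_nonneg t) ht) ?_
  intro n
  rw [Real.norm_eq_abs, abs_mul, abs_pow]
  exact mul_le_of_le_one_left (by positivity) (hf n)

lemma summable_I (w : List Lt) {t : ℝ} (ht : |t| < 1) : Summable (fun n => co w n * t ^ n) :=
  summable_pow_of_bdd (abs_co_le_one w) ht

lemma hasDerivAt_ps {f : ℕ → ℝ} (hf : ∀ n, |f n| ≤ 1) {t : ℝ} (ht : |t| < 1) :
    HasDerivAt (fun t => ∑' n, f n * t ^ n) (∑' n, f n * (n * t ^ (n - 1))) t := by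
  obtain ⟨r, hr1, hr2⟩ := exists_between ht
  have hr0 : 0 ≤ r := (abs_nonneg t).trans hr1.le
  refine hasDerivAt_tsum_of_isPreconnected (u := fun n : ℕ => (n : ℝ) * r ^ (n - 1))
    (t := Metric.ball (0:ℝ) r) (y₀ := t) (g := fun n t => f n * t ^ n)
    (g' := fun n t => f n * (n * t ^ (n - 1))) ?_ Metric.isOpen_ball
    (convex_ball (0:ℝ) r).isPreconnected ?_ ?_ ?_ ?_ ?_
  · have := summable_pow_mul_geometric_of_norm_lt_one 1 (r := r) (by rw [Real.norm_eq_abs, abs_of_nonneg hr0]; exact hr2)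
    rw [← summable_nat_add_iff 1]
    have h2 := summable_geometric_of_lt_one hr0 hr2
    refine (this.add h2).congr ?_
    intro n
    simp; ring
  · intro n y _
    exact (hasDerivAt_pow n y).const_mul (f n)
  · intro n y hy
    rw [Metric.mem_ball, dist_zero_right, Real.norm_eq_abs] at hy
    rw [Real.norm_eq_abs, abs_mul, abs_mul, abs_pow, Nat.abs_cast]
    calc |f n| * (n * |y| ^ (n-1)) ≤ 1 * (n * |y| ^ (n-1)) := by
          gcongr; exact hf n
      _ ≤ _ := by rw [one_mul]; gcongr
  · simpa using hr1
  · exact summable_pow_of_bdd hf ht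
  · simpa using hr1

lemma ps_c {f : ℕ → ℝ} (hf : ∀ n, |f n| ≤ 1) {t : ℝ} (ht : |t| < 1) :
    ∑' n, (∑ k ∈ Finset.range (n+1), f k) * t ^ n = 1 / (1 - t) * ∑' n, f n * t ^ n := by
  have hg : Summable (fun n => t ^ n) := summable_geometric_of_abs_lt_one ht
  have h := tsum_mul_tsum_eq_tsum_sum_range_of_summable_norm (summable_pow_of_bdd hf ht).norm hg.norm
  rw [tsum_geometric_of_abs_lt_one ht] at h
  rw [one_div, mul_comm, h]
  congr 1; ext n
  rw [Finset.sum_mul]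
  refine Finset.sum_congr rfl fun k hk => ?_
  rw [mul_assoc, ← pow_add, Nat.add_sub_cancel' (by simpa [Nat.lt_succ_iff] using hk)]

lemma ps_b {f : ℕ → ℝ} (hf : ∀ n, |f n| ≤ 1) {t : ℝ} (ht : |t| < 1) :
    ∑' n, ((-1) ^ n * ∑ k ∈ Finset.range (n+1), (-1) ^ k * f k) * t ^ n = 1 / (1 + t) * ∑' n, f n * t ^ n := by
  have h := ps_c (f := fun k => (-1) ^ k * f k) (t := -t) (fun n => by
    rw [abs_mul, abs_pow, abs_neg, abs_one, one_pow, one_mul]; exact hf n) (by rwa [abs_neg])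
  rw [sub_neg_eq_add] at h
  convert h using 2
  · ext n
    rw [neg_pow t]; ring
  · congr 1; ext n
    rw [neg_pow t]
    have : ((-1:ℝ) ^ n) * (-1) ^ n = 1 := by rw [← mul_pow]; simp
    linear_combination (- f n * t ^ n) * this

lemma hasDerivAt_I (x : Lt) (w : List Lt) (hx : x = Lt.a → w ≠ []) {t : ℝ} (ht0 : 0 < t) (ht1 : t < 1) :
    HasDerivAt (I (x :: w)) (om x t * I w t) t := by
  have ht : |t| < 1 := by rw [abs_of_pos ht0]; exact ht1
  have h : HasDerivAt (I (x :: w)) (∑' n, co (x :: w) n * (n * t ^ (n - 1))) t :=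
    hasDerivAt_ps (abs_co_le_one (x :: w)) ht
  convert h using 1
  have hs : ∀ g : ℕ → ℝ, ∑' n, g n * (n * t ^ (n-1)) = ∑' n : ℕ, (g (n+1) * (n+1)) * t ^ n := by
    intro g
    have : ∀ n ∉ Set.range Nat.succ, g n * (n * t ^ (n-1)) = 0 := by
      intro n hn
      have : n = 0 := by
        by_contra h0
        exact hn ⟨n - 1, Nat.succ_pred_eq_of_pos (Nat.pos_of_ne_zero h0)⟩
      subst this; simp
    rw [← tsum_subtype_eq_of_support_subset (s := Set.range Nat.succ)]
    · rw [tsum_range (f := fun n => g n * (n * t ^ (n-1))) Nat.succ_injective]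
      congr 1; ext n; simp; ring
    · intro n hn
      by_contra hh
      exact hn (this n hh)
  rw [hs]
  have hn1 : ∀ n : ℕ, (n : ℝ) + 1 ≠ 0 := fun n => by positivity
  cases x with
  | a =>
    have hw := hx rfl
    simp only [om, I]
    rw [(summable_I w ht).tsum_eq_zero_add, co_zero' hw, zero_mul, zero_add, ← tsum_mul_left]
    congr 1; ext n
    simp only [co]; push_cast
    rw [div_mul_cancel₀ _ (hn1 n), pow_succ]; field_simp
  | b =>
    simp only [om, I]
    rw [← ps_b (abs_co_le_one w) ht]
    congr 1; ext n
    simp only [co]; push_cast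
    rw [div_mul_cancel₀ _ (hn1 n), pow_add, pow_add]; norm_num
  | c =>
    simp only [om, I]
    rw [← ps_c (abs_co_le_one w) ht]
    congr 1; ext n
    simp only [co]; push_cast
    rw [div_mul_cancel₀ _ (hn1 n)]

lemma continuousAt_I (w : List Lt) {t : ℝ} (ht : |t| < 1) : ContinuousAt (I w) t :=
  (hasDerivAt_ps (abs_co_le_one w) ht).continuousAt

lemma I_nil (t : ℝ) : I [] t = 1 := by
  unfold I
  rw [tsum_eq_single 0]
  · simp [co]
  · intro n hn; simp [co, hn]

lemma I_zero {w : List Lt} (hw : w ≠ []) : I w 0 = 0 := by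
  unfold I
  rw [tsum_eq_single 0]
  · simp [co_zero' hw]
  · intro n hn; simp [hn]

/-- uniqueness -/
lemma eq_of_deriv {f g f' : ℝ → ℝ} (h0 : f 0 = g 0)
    (hfc : ∀ t, 0 ≤ t → t < 1 → ContinuousAt f t) (hgc : ∀ t, 0 ≤ t → t < 1 → ContinuousAt g t)
    (hf : ∀ t, 0 < t → t < 1 → HasDerivAt f (f' t) t)
    (hg : ∀ t, 0 < t → t < 1 → HasDerivAt g (f' t) t) {t : ℝ} (ht0 : 0 ≤ t) (ht1 : t < 1) :
    f t = g t := by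
  rcases ht0.eq_or_lt with h | h
  · rw [← h, h0]
  · obtain ⟨c, hc, hc2⟩ := exists_hasDerivAt_eq_slope (fun s => f s - g s) (fun s => f' s - f' s) h
      (fun s hs => ((hfc s hs.1 (hs.2.trans_lt ht1)).sub (hgc s hs.1 (hs.2.trans_lt ht1))).continuousWithinAt)
      (fun s hs => (hf s hs.1 (hs.2.trans ht1)).sub (hg s hs.1 (hs.2.trans ht1)))
    simp only [sub_self, h0, sub_zero] at hc2
    have h3 := hc2.symm
    rw [div_eq_zero_iff] at h3
    rcases h3 with h3 | h3
    · linarith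
    · linarith

end AZ

open Real
namespace AZ
open Lt Filter Topology

def sh : List Lt → List Lt → List (List Lt)
  | [], v => [v]
  | x :: u, [] => [x :: u]
  | x :: u, y :: v => (sh u (y :: v)).map (List.cons x) ++ (sh (x :: u) v).map (List.cons y)
termination_by u v => u.length + v.length

lemma length_sh (n : ℕ) : ∀ u v : List Lt, u.length + v.length = n → ∀ w ∈ sh u v, w.length = n := by
  induction n with
  | zero =>
    intro u v h w hw
    have hu : u = [] := by cases u with
      | nil => rfl
      | cons => simp at h
    have hv : v = [] := by cases v with
      | nil => rfl
      | cons => simp at h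
    subst hu; subst hv
    simp [sh] at hw; simp [hw]
  | succ n ih =>
    intro u v h w hw
    cases u with
    | nil => simp [sh] at hw; subst hw; simpa using h
    | cons x u =>
      cases v with
      | nil => simp [sh] at hw; subst hw; simpa using h
      | cons y v =>
        simp only [List.length_cons] at h
        simp only [sh, List.mem_append, List.mem_map] at hw
        rcases hw with ⟨w', hw', rfl⟩ | ⟨w', hw', rfl⟩
        · have := ih u (y :: v) (by simp only [List.length_cons]; omega) w' hw'
          simp [this]
        · have := ih (x :: u) v (by simp only [List.length_cons]; omega) w' hw'
          simp [this]

/-- words not ending in the letter `a` -/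
def good : List Lt → Prop
  | [] => True
  | x :: w => (x = Lt.a → w ≠ []) ∧ good w

noncomputable def SI (L : List (List Lt)) (t : ℝ) : ℝ := (L.map (fun w => I w t)).sum

lemma SI_append (L M : List (List Lt)) (t : ℝ) : SI (L ++ M) t = SI L t + SI M t := by
  simp [SI]

lemma SI_cons (w : List Lt) (M : List (List Lt)) (t : ℝ) : SI (w :: M) t = I w t + SI M t := by
  simp [SI]

lemma SI_nil (t : ℝ) : SI [] t = 0 := by
  simp [SI]

lemma hasDerivAt_SI (x : Lt) (L : List (List Lt)) (hL : ∀ w ∈ L, w ≠ []) {t : ℝ} (ht0 : 0 < t) (ht1 : t < 1) :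
    HasDerivAt (SI (L.map (List.cons x))) (om x t * SI L t) t := by
  induction L with
  | nil => 
    have : SI (List.map (List.cons x) []) = fun _ => 0 := by ext s; simp [SI]
    rw [this, SI_nil, mul_zero]
    exact hasDerivAt_const t 0
  | cons w L ih =>
    have : SI (List.map (List.cons x) (w :: L)) = fun s => I (x :: w) s + SI (L.map (List.cons x)) s := by
      ext s; simp [SI]
    rw [this, SI_cons, mul_add]
    exact (hasDerivAt_I x w (fun _ => hL w (by simp)) ht0 ht1).add (ih (fun w hw => hL w (by simp [hw])))

lemma continuousAt_SI (L : List (List Lt)) {t : ℝ} (ht : |t| < 1) : ContinuousAt (SI L) t := by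
  induction L with
  | nil => 
    have : SI [] = fun _ => 0 := by ext s; simp [SI]
    rw [this]
    exact continuousAt_const
  | cons w L ih =>
    have : SI (w :: L) = fun s => I w s + SI L s := by
      ext s; simp [SI]
    rw [this]
    exact (continuousAt_I w ht).add ih

lemma SI_zero (L : List (List Lt)) (hL : ∀ w ∈ L, w ≠ []) : SI L 0 = 0 := by
  induction L with
  | nil => exact SI_nil 0
  | cons w L ih => 
    rw [SI_cons, I_zero (hL w (by simp)), ih (fun w hw => hL w (by simp [hw])), add_zero]

lemma shuffle (n : ℕ) : ∀ u v : List Lt, u.length + v.length = n → good u → good v →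
    ∀ t : ℝ, 0 ≤ t → t < 1 → I u t * I v t = SI (sh u v) t := by
  induction n with
  | zero =>
    intro u v h _ _ t _ _
    have hu : u = [] := by cases u with
      | nil => rfl
      | cons => simp at h
    subst hu
    simp [sh, SI, I_nil]
  | succ n ih =>
    intro u v h hu hv t ht0 ht1
    cases u with
    | nil => simp [sh, SI, I_nil]
    | cons x u =>
      cases v with
      | nil => simp [sh, SI, I_nil]
      | cons y v =>
        simp only [List.length_cons] at h
        have abs1 : ∀ t : ℝ, 0 ≤ t → t < 1 → |t| < 1 := fun t h0 h1 => by rwa [abs_of_nonneg h0]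
        have n1 : ∀ w ∈ sh u (y :: v), w ≠ [] := fun w hw h0 => by
          have := length_sh _ _ _ rfl w hw
          subst h0; simp at this
        have n2 : ∀ w ∈ sh (x :: u) v, w ≠ [] := fun w hw h0 => by
          have := length_sh _ _ _ rfl w hw
          subst h0; simp at this; omega
        refine eq_of_deriv (f := fun t => I (x :: u) t * I (y :: v) t) (g := SI (sh (x :: u) (y :: v)))
          (f' := fun t => om x t * I u t * I (y :: v) t + I (x :: u) t * (om y t * I v t)) ?_ ?_ ?_ ?_ ?_ ht0 ht1
        · rw [I_zero (by simp), zero_mul, SI_zero]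
          intro w hw h0
          have := length_sh _ _ _ rfl w hw
          subst h0; simp at this
        · intro t h0 h1
          exact (continuousAt_I _ (abs1 t h0 h1)).mul (continuousAt_I _ (abs1 t h0 h1))
        · intro t h0 h1
          exact continuousAt_SI _ (abs1 t h0 h1)
        · intro t h0 h1
          exact (hasDerivAt_I x u hu.1 h0 h1).mul (hasDerivAt_I y v hv.1 h0 h1)
        · intro t h0 h1
          have e : SI (sh (x :: u) (y :: v)) = fun s => SI ((sh u (y :: v)).map (List.cons x)) s +
              SI ((sh (x :: u) v).map (List.cons y)) s := by
            ext s; rw [sh, SI_append]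
          rw [e]
          have := (hasDerivAt_SI x _ n1 h0 h1).add (hasDerivAt_SI y _ n2 h0 h1)
          refine this.congr_deriv ?_
          rw [← ih u (y :: v) (by simp only [List.length_cons]; omega) hu.2 hv t h0.le h1,
            ← ih (x :: u) v (by simp only [List.length_cons]; omega) hu hv.2 t h0.le h1]
          ring

end AZ

open Real
namespace AZ
open Lt Filter Topology

noncomputable def qr (n : ℕ) : ℝ := (n : ℝ) ^ (1/4 : ℝ)

lemma qr_pow (n : ℕ) : qr n ^ 4 = n := by
  unfold qr
  rw [← Real.rpow_natCast, ← Real.rpow_mul (Nat.cast_nonneg n)]; norm_num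

lemma qr_nonneg (n : ℕ) : 0 ≤ qr n := by unfold qr; positivity

lemma qr_pos {n : ℕ} (h : 0 < n) : 0 < qr n := by
  unfold qr
  have : (0:ℝ) < n := by exact_mod_cast h
  positivity

lemma one_le_qr {n : ℕ} (h : 0 < n) : 1 ≤ qr n := by
  unfold qr
  apply Real.one_le_rpow _ (by norm_num)
  exact_mod_cast h

lemma qr_mono {m n : ℕ} (h : m ≤ n) : qr m ≤ qr n := by
  unfold qr
  apply Real.rpow_le_rpow (Nat.cast_nonneg m) _ (by norm_num)
  exact_mod_cast h

lemma sum_qr (n : ℕ) : ∑ k ∈ Finset.range n, 1 / qr (k+1) ^ 3 ≤ 4 * qr n := by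
  induction n with
  | zero => simp [qr]
  | succ n ih =>
    rw [Finset.sum_range_succ]
    have hx := qr_pos (Nat.succ_pos n)
    have hy := qr_nonneg n
    have h1 := qr_pow (n+1)
    have h2 := qr_pow n
    have hm := qr_mono (Nat.le_succ n)
    simp only [Nat.succ_eq_add_one] at hx hm
    push_cast at h1
    generalize qr (n+1) = x at *
    generalize qr n = y at *
    have : 1 / x ^ 3 ≤ 4 * x - 4 * y := by
      rw [div_le_iff₀ (by positivity)]
      have e : (1:ℝ) = (x - y) * (x^3 + x^2*y + x*y^2 + y^3) := by linear_combination h2 - h1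
      have b : x^3 + x^2*y + x*y^2 + y^3 ≤ 4 * x ^ 3 := by
        have h1 : x^2*y ≤ x^2 * x := by gcongr
        have h2 : x*y^2 ≤ x * x^2 := by gcongr
        have h3 : y^3 ≤ x^3 := by gcongr
        nlinarith
      nlinarith [mul_le_mul_of_nonneg_left b (sub_nonneg.2 hm)]
    linarith

lemma co_bound (w : List Lt) : ∃ C : ℝ, 0 ≤ C ∧ ∀ n : ℕ, 0 < n → |co w n| ≤ C / qr n ^ 3 := by
  induction w with
  | nil => exact ⟨0, le_rfl, fun n hn => by simp [co, hn.ne']⟩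
  | cons x w ih =>
    obtain ⟨C, hC, h⟩ := ih
    have key : ∀ n : ℕ, 0 < n → (∑ k ∈ Finset.range n, |co w k|) / n ≤ (1 + 4 * C) / qr n ^ 3 := by
      intro n hn
      have h1 : ∑ k ∈ Finset.range n, |co w k| ≤ 1 + 4 * C * qr n := by
        obtain ⟨m, rfl⟩ : ∃ m, n = m + 1 := ⟨n - 1, by omega⟩
        rw [Finset.sum_range_succ']
        have : ∑ k ∈ Finset.range m, |co w (k+1)| ≤ C * (4 * qr m) := by
          refine le_trans ?_ (mul_le_mul_of_nonneg_left (sum_qr m) hC)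
          rw [Finset.mul_sum]
          refine Finset.sum_le_sum fun k _ => ?_
          rw [mul_one_div]
          exact h (k+1) (Nat.succ_pos k)
        have h0 := abs_co_le_one w 0
        have := mul_le_mul_of_nonneg_left (qr_mono (Nat.le_succ m)) hC
        simp only [Nat.succ_eq_add_one] at this
        linarith
      have hq := one_le_qr hn
      have hq4 := qr_pow n
      have hp : 0 < qr n := qr_pos hn
      rw [← hq4, div_le_div_iff₀ (by positivity) (by positivity)]
      have : ∑ k ∈ Finset.range n, |co w k| ≤ (1 + 4 * C) * qr n := by nlinarith
      calc _ ≤ (1 + 4 * C) * qr n * qr n ^ 3 := by gcongr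
        _ = _ := by ring
    cases x with
    | a =>
      refine ⟨C, hC, fun n hn => ?_⟩
      simp only [co]
      rw [abs_div, Nat.abs_cast]
      refine le_trans (div_le_self (abs_nonneg _) ?_) (h n hn)
      exact_mod_cast hn
    | b =>
      refine ⟨1 + 4 * C, by positivity, fun n hn => le_trans ?_ (key n hn)⟩
      simp only [co]
      rw [abs_div, Nat.abs_cast, abs_mul, abs_pow, abs_neg, abs_one, one_pow, one_mul]
      gcongr
      refine (Finset.abs_sum_le_sum_abs _ _).trans (Finset.sum_le_sum fun k _ => ?_)
      rw [abs_mul, abs_pow, abs_neg, abs_one, one_pow, one_mul]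
    | c =>
      refine ⟨1 + 4 * C, by positivity, fun n hn => le_trans ?_ (key n hn)⟩
      simp only [co]
      rw [abs_div, Nat.abs_cast]
      gcongr
      exact Finset.abs_sum_le_sum_abs _ _

/-- summability for `a`-first words, even with a factor of harmonic size -/
lemma summable_co_a' (w : List Lt) : Summable (fun n => |co (Lt.a :: w) n| * qr n) := by
  obtain ⟨C, hC, h⟩ := co_bound w
  have hs : Summable (fun n : ℕ => C * (1 / (n : ℝ) ^ (3/2 : ℝ))) :=
    (Real.summable_one_div_nat_rpow.2 (by norm_num)).mul_left C
  refine Summable.of_nonneg_of_le (fun n => mul_nonneg (abs_nonneg _) (qr_nonneg n)) (fun n => ?_) hs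
  rcases Nat.eq_zero_or_pos n with h0 | h0
  · subst h0; rw [co_zero]; simp
  · have hp := qr_pos h0
    have e : (n : ℝ) ^ (3/2 : ℝ) = qr n ^ 6 := by
      unfold qr
      rw [← Real.rpow_natCast, ← Real.rpow_mul (Nat.cast_nonneg n)]; norm_num
    rw [e]
    simp only [co]
    rw [abs_div, Nat.abs_cast]
    have := h n h0
    have hq4 := qr_pow n
    calc |co w n| / n * qr n ≤ (C / qr n ^ 3) / (qr n ^ 4) * qr n := by rw [← hq4]; gcongr
      _ = _ := by field_simp

lemma summable_co_a (w : List Lt) : Summable (fun n => |co (Lt.a :: w) n|) := by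
  refine Summable.of_nonneg_of_le (fun n => abs_nonneg _) (fun n => ?_) (summable_co_a' w)
  rcases Nat.eq_zero_or_pos n with h0 | h0
  · subst h0; rw [co_zero]; simp
  · exact le_mul_of_one_le_right (abs_nonneg _) (one_le_qr h0)

noncomputable def Z (w : List Lt) : ℝ := limUnder (𝓝[<] (1:ℝ)) (I w)

def Cv (w : List Lt) : Prop :=
  (∃ M, ∀ t ∈ Set.Ioo (0:ℝ) 1, |I w t| ≤ M) ∧ Tendsto (I w) (𝓝[<] (1:ℝ)) (𝓝 (Z w))

lemma Z_eq {w : List Lt} {l : ℝ} (h : Tendsto (I w) (𝓝[<] (1:ℝ)) (𝓝 l)) : Z w = l := h.limUnder_eq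

lemma Abel {w : List Lt} {l : ℝ} (h : Tendsto (fun n => ∑ i ∈ Finset.range n, co w i) atTop (𝓝 l)) :
    Tendsto (I w) (𝓝[<] (1:ℝ)) (𝓝 l) :=
  Real.tendsto_tsum_powerSeries_nhdsWithin_lt h

lemma Z_a (w : List Lt) : Z (Lt.a :: w) = ∑' n, co (Lt.a :: w) n :=
  Z_eq (Abel (summable_co_a w).of_abs.hasSum.tendsto_sum_nat)

lemma Cv_a (w : List Lt) : Cv (Lt.a :: w) := by
  refine ⟨⟨∑' n, |co (Lt.a :: w) n|, fun t ht => ?_⟩, ?_⟩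
  · unfold I
    have hs := summable_I (Lt.a :: w) (t := t) (by rw [abs_of_pos ht.1]; exact ht.2)
    have := norm_tsum_le_tsum_norm hs.norm
    refine (Real.norm_eq_abs _ ▸ this).trans ?_
    refine Summable.tsum_le_tsum (fun n => ?_) hs.norm (summable_co_a w)
    rw [Real.norm_eq_abs, abs_mul, abs_pow, abs_of_pos ht.1]
    exact mul_le_of_le_one_right (abs_nonneg _) (pow_le_one₀ ht.1.le ht.2.le)
  · rw [Z_a]
    exact Abel (summable_co_a w).of_abs.hasSum.tendsto_sum_nat

lemma Ioo_mem_lt : Set.Ioo (0:ℝ) 1 ∈ 𝓝[<] (1:ℝ) := Ioo_mem_nhdsLT (by norm_num)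

lemma Cv_of_ext {w : List Lt} {g : ℝ → ℝ} (hg : Continuous g) (h : ∀ t ∈ Set.Ioo (0:ℝ) 1, I w t = g t) : Cv w := by
  have ht : Tendsto (I w) (𝓝[<] (1:ℝ)) (𝓝 (g 1)) := by
    have : Tendsto g (𝓝[<] (1:ℝ)) (𝓝 (g 1)) := hg.continuousAt.mono_left nhdsWithin_le_nhds
    refine this.congr' ?_
    filter_upwards [Ioo_mem_lt] with t ht
    exact (h t ht).symm
  refine ⟨?_, by rwa [Z_eq ht]⟩
  obtain ⟨M, hM⟩ := (isCompact_Icc (a := (0:ℝ)) (b := 1)).exists_bound_of_continuousOn hg.continuousOn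
  exact ⟨M, fun t ht => by rw [h t ht]; exact hM t ⟨ht.1.le, ht.2.le⟩⟩

lemma Cv_b {w : List Lt} (hw : Cv w) : Cv (Lt.b :: w) := by
  obtain ⟨M, hM⟩ := hw.1
  have hM0 : 0 ≤ M := (abs_nonneg _).trans (hM (1/2) (by norm_num))
  have hL : LipschitzOnWith (NNReal.mk M hM0) (I (Lt.b :: w)) (Set.Ioo (0:ℝ) 1) := by
    refine (convex_Ioo (0:ℝ) 1).lipschitzOnWith_of_nnnorm_hasDerivWithin_le (f' := fun t => om Lt.b t * I w t)
      (fun t ht => (hasDerivAt_I Lt.b w (by simp) ht.1 ht.2).hasDerivWithinAt) (fun t ht => ?_)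
    rw [← NNReal.coe_le_coe, coe_nnnorm, NNReal.coe_mk, Real.norm_eq_abs, abs_mul]
    refine (mul_le_of_le_one_left (abs_nonneg _) ?_).trans (hM t ht)
    simp only [om]
    have := ht.1
    rw [abs_of_pos (by positivity), div_le_one (by positivity)]
    linarith
  obtain ⟨g, hg, he⟩ := hL.extend_real
  exact Cv_of_ext hg.continuous he

lemma Cv_nil : Cv [] := Cv_of_ext (g := fun _ => 1) continuous_const (fun t _ => I_nil t)

lemma Z_nil : Z [] = 1 := by
  apply Z_eq
  have : I [] = fun _ => 1 := by ext t; exact I_nil t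
  rw [this]; exact tendsto_const_nhds

/-- words for which the limit at `1` is known to exist -/
def okw : List Lt → Prop
  | [] => True
  | Lt.a :: w => w ≠ []
  | Lt.b :: w => okw w
  | Lt.c :: _ => False

lemma Cv_ok {w : List Lt} (h : okw w) : Cv w := by
  induction w with
  | nil => exact Cv_nil
  | cons x w ih =>
    cases x with
    | a => exact Cv_a w
    | b => exact Cv_b (ih h)
    | c => exact absurd h (by simp [okw])

lemma okw_sh (n : ℕ) : ∀ u v : List Lt, u.length + v.length = n → okw u → okw v → ∀ w ∈ sh u v, okw w := by
  induction n with
  | zero =>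
    intro u v h _ _ w hw
    have := length_sh 0 u v h w hw
    cases w with
    | nil => trivial
    | cons => simp at this
  | succ n ih =>
    intro u v h hu hv w hw
    cases u with
    | nil => simp [sh] at hw; subst hw; exact hv
    | cons x u =>
      cases v with
      | nil => simp [sh] at hw; subst hw; exact hu
      | cons y v =>
        simp only [List.length_cons] at h
        simp only [sh, List.mem_append, List.mem_map] at hw
        rcases hw with ⟨w', hw', rfl⟩ | ⟨w', hw', rfl⟩
        · have hl := length_sh n u (y :: v) (by simp only [List.length_cons]; omega) w' hw'
          cases x with
          | a => 
            intro h0; rw [h0] at hl; simp at hl; omega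
          | b => exact ih u (y :: v) (by simp only [List.length_cons]; omega) hu hv w' hw'
          | c => exact absurd hu (by simp [okw])
        · have hl := length_sh n (x :: u) v (by simp only [List.length_cons]; omega) w' hw'
          cases y with
          | a => 
            intro h0; rw [h0] at hl; simp at hl; omega
          | b => exact ih (x :: u) v (by simp only [List.length_cons]; omega) hu hv w' hw'
          | c => exact absurd hv (by simp [okw])

noncomputable def SZ (L : List (List Lt)) : ℝ := (L.map Z).sum

lemma tendsto_SI (L : List (List Lt)) (h : ∀ w ∈ L, Cv w) : Tendsto (SI L) (𝓝[<] (1:ℝ)) (𝓝 (SZ L)) := by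
  induction L with
  | nil =>
    have : SI [] = fun _ => 0 := by ext s; simp [SI]
    rw [this]; simp only [SZ, List.map_nil, List.sum_nil]; exact tendsto_const_nhds
  | cons w L ih =>
    have : SI (w :: L) = fun s => I w s + SI L s := by
      ext s; simp [SI]
    rw [this]
    simp only [SZ, List.map_cons, List.sum_cons]
    exact (h w (by simp)).2.add (ih (fun w hw => h w (by simp [hw])))

theorem shZ (u v : List Lt) (gu : good u) (gv : good v) (hu : okw u) (hv : okw v) :
    Z u * Z v = SZ (sh u v) := by
  have h1 := (Cv_ok hu).2.mul (Cv_ok hv).2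
  have h2 := tendsto_SI (sh u v) (fun w hw => Cv_ok (okw_sh _ u v rfl hu hv w hw))
  refine tendsto_nhds_unique h1 (h2.congr' ?_)
  filter_upwards [Ioo_mem_lt] with t ht
  exact (shuffle _ u v rfl gu gv t ht.1.le ht.2).symm

end AZ

open Real
namespace AZ
open Lt Filter Topology

noncomputable def LI (L : List (ℝ × List Lt)) (t : ℝ) : ℝ := (L.map (fun p => p.1 * I p.2 t)).sum
noncomputable def LZ (L : List (ℝ × List Lt)) : ℝ := (L.map (fun p => p.1 * Z p.2)).sum

def pre (c : ℝ) (y : Lt) (L : List (ℝ × List Lt)) : List (ℝ × List Lt) :=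
  L.map (fun p => (c * p.1, y :: p.2))

def pres : List (ℝ × Lt) → List (ℝ × List Lt) → List (ℝ × List Lt)
  | [], _ => []
  | q :: M, L => pre q.1 q.2 L ++ pres M L

def sub (m : Lt → List (ℝ × Lt)) : List Lt → List (ℝ × List Lt)
  | [] => [(1, [])]
  | x :: w => pres (m x) (sub m w)

lemma LI_append (L M : List (ℝ × List Lt)) (t : ℝ) : LI (L ++ M) t = LI L t + LI M t := by
  simp [LI]

lemma mem_pres {M : List (ℝ × Lt)} {L : List (ℝ × List Lt)} {p : ℝ × List Lt} (h : p ∈ pres M L) :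
    ∃ q ∈ M, ∃ r ∈ L, p = (q.1 * r.1, q.2 :: r.2) := by
  induction M with
  | nil => simp [pres] at h
  | cons q M ih =>
    simp only [pres, List.mem_append, pre, List.mem_map] at h
    rcases h with ⟨r, hr, rfl⟩ | h
    · exact ⟨q, by simp, r, hr, rfl⟩
    · obtain ⟨q', hq', r, hr, e⟩ := ih h
      exact ⟨q', by simp [hq'], r, hr, e⟩

lemma length_sub (m : Lt → List (ℝ × Lt)) (w : List Lt) : ∀ p ∈ sub m w, p.2.length = w.length := by
  induction w with
  | nil => simp [sub]
  | cons x w ih =>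
    intro p hp
    obtain ⟨q, hq, r, hr, rfl⟩ := mem_pres hp
    simp [ih r hr]

lemma LI_nil_fun : LI [] = fun _ => 0 := by ext; simp [LI]

lemma hasDerivAt_pre (c : ℝ) (y : Lt) (L : List (ℝ × List Lt)) (h : ∀ p ∈ L, y = Lt.a → p.2 ≠ [])
    {t : ℝ} (ht0 : 0 < t) (ht1 : t < 1) : HasDerivAt (LI (pre c y L)) (c * om y t * LI L t) t := by
  induction L with
  | nil =>
    simp only [pre, List.map_nil, LI_nil_fun, mul_zero]
    exact hasDerivAt_const t 0
  | cons p L ih =>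
    have e : LI (pre c y (p :: L)) = fun s => c * p.1 * I (y :: p.2) s + LI (pre c y L) s := by
      ext s; simp [LI, pre]
    rw [e]
    have h1 := ((hasDerivAt_I y p.2 (h p (by simp)) ht0 ht1).const_mul (c * p.1)).add
      (ih (fun q hq => h q (by simp [hq])))
    refine h1.congr_deriv ?_
    simp [LI]; ring

lemma hasDerivAt_pres (M : List (ℝ × Lt)) (L : List (ℝ × List Lt))
    (h : ∀ q ∈ M, ∀ p ∈ L, q.2 = Lt.a → p.2 ≠ [])
    {t : ℝ} (ht0 : 0 < t) (ht1 : t < 1) :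
    HasDerivAt (LI (pres M L)) ((M.map (fun q => q.1 * om q.2 t)).sum * LI L t) t := by
  induction M with
  | nil =>
    simp only [pres, List.map_nil, LI_nil_fun, List.sum_nil, zero_mul]
    exact hasDerivAt_const t 0
  | cons q M ih =>
    have e : LI (pres (q :: M) L) = fun s => LI (pre q.1 q.2 L) s + LI (pres M L) s := by
      ext s; rw [pres, LI_append]
    rw [e]
    have h1 := (hasDerivAt_pre q.1 q.2 L (h q (by simp)) ht0 ht1).add
      (ih (fun q hq => h q (by simp [hq])))
    refine h1.congr_deriv ?_
    simp; ring

lemma continuousAt_LI (L : List (ℝ × List Lt)) {t : ℝ} (ht : |t| < 1) : ContinuousAt (LI L) t := by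
  induction L with
  | nil => rw [LI_nil_fun]; exact continuousAt_const
  | cons p L ih =>
    have e : LI (p :: L) = fun s => p.1 * I p.2 s + LI L s := by ext s; simp [LI]
    rw [e]
    exact ((continuousAt_I p.2 ht).const_mul p.1).add ih

lemma LI_zero (L : List (ℝ × List Lt)) (h : ∀ p ∈ L, p.2 ≠ []) : LI L 0 = 0 := by
  induction L with
  | nil => simp [LI]
  | cons p L ih =>
    have e : LI (p :: L) = fun s => p.1 * I p.2 s + LI L s := by ext s; simp [LI]
    rw [e]
    simp [ih (fun q hq => h q (by simp [hq])), I_zero (h p (by simp))]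

lemma tendsto_LI (L : List (ℝ × List Lt)) (h : ∀ p ∈ L, Cv p.2) : Tendsto (LI L) (𝓝[<] (1:ℝ)) (𝓝 (LZ L)) := by
  induction L with
  | nil => simp only [LI_nil_fun, LZ, List.map_nil, List.sum_nil]; exact tendsto_const_nhds
  | cons p L ih =>
    have e : LI (p :: L) = fun s => p.1 * I p.2 s + LI L s := by ext s; simp [LI]
    rw [e]
    simp only [LZ, List.map_cons, List.sum_cons]
    exact ((h p (by simp)).2.const_mul p.1).add (ih (fun q hq => h q (by simp [hq])))

structure Sb (m : Lt → List (ℝ × Lt)) (φ φ' : ℝ → ℝ) : Prop where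
  zero : φ 0 = 0
  cont : ∀ t, 0 ≤ t → t < 1 → ContinuousAt φ t
  nonneg : ∀ t, 0 ≤ t → t < 1 → 0 ≤ φ t
  pos : ∀ t, 0 < t → t < 1 → 0 < φ t
  lt : ∀ t, 0 ≤ t → t < 1 → φ t < 1
  deriv : ∀ t, 0 < t → t < 1 → HasDerivAt φ (φ' t) t
  omeq : ∀ x, x ≠ Lt.b → ∀ t, 0 < t → t < 1 → om x (φ t) * φ' t = ((m x).map (fun q => q.1 * om q.2 t)).sum
  na : ∀ x, x ≠ Lt.a → ∀ q ∈ m x, q.2 ≠ Lt.a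

def noB : List Lt → Prop
  | [] => True
  | x :: w => x ≠ Lt.b ∧ noB w

lemma subst {m : Lt → List (ℝ × Lt)} {φ φ' : ℝ → ℝ} (H : Sb m φ φ') (w : List Lt) (gw : good w) (bw : noB w) :
    ∀ t, 0 ≤ t → t < 1 → I w (φ t) = LI (sub m w) t := by
  induction w with
  | nil => intro t _ _; simp [sub, LI, I_nil]
  | cons x w ih =>
    intro t ht0 ht1
    have ih' := ih gw.2 bw.2
    refine eq_of_deriv (f := fun t => I (x :: w) (φ t)) (g := LI (sub m (x :: w)))
      (f' := fun t => om x (φ t) * I w (φ t) * φ' t) ?_ ?_ ?_ ?_ ?_ ht0 ht1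
    · have : LI (sub m (x :: w)) 0 = 0 := LI_zero _ (fun p hp h0 => by
        have := length_sub m (x :: w) p hp
        rw [h0] at this; simp at this)
      rw [this, H.zero, I_zero (by simp)]
    · intro t h0 h1
      have : ContinuousAt (I (x :: w)) (φ t) := continuousAt_I _ (by
        rw [abs_of_nonneg (H.nonneg t h0 h1)]; exact H.lt t h0 h1)
      exact ContinuousAt.comp (f := φ) this (H.cont t h0 h1)
    · intro t h0 h1
      exact continuousAt_LI _ (by rwa [abs_of_nonneg h0])
    · intro t h0 h1
      exact (hasDerivAt_I x w gw.1 (H.pos t h0 h1) (H.lt t h0.le h1)).comp t (H.deriv t h0 h1)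
    · intro t h0 h1
      have := hasDerivAt_pres (m x) (sub m w) (fun q hq p hp hqa hp0 => by
        by_cases hx : x = Lt.a
        · have hl := length_sub m w p hp
          rw [hp0] at hl
          apply gw.1 hx
          exact List.length_eq_zero_iff.1 hl.symm
        · exact H.na x hx q hq hqa) h0 h1
      refine this.congr_deriv ?_
      rw [← H.omeq x bw.1 t h0 h1, ← ih' t h0.le h1]; ring

def mSQ : Lt → List (ℝ × Lt)
  | Lt.a => [(2, Lt.a)]
  | Lt.b => []
  | Lt.c => [(1, Lt.c), (-1, Lt.b)]

def mHALF : Lt → List (ℝ × Lt)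
  | Lt.a => [(1, Lt.a), (-1, Lt.b)]
  | Lt.b => []
  | Lt.c => [(1, Lt.b)]

def mPHI : Lt → List (ℝ × Lt)
  | Lt.a => [(1, Lt.a), (-2, Lt.b)]
  | Lt.b => []
  | Lt.c => [(2, Lt.c), (2, Lt.b)]

lemma SbSQ : Sb mSQ (fun t => t ^ 2) (fun t => 2 * t) where
  zero := by norm_num
  cont := fun t _ _ => by fun_prop
  nonneg := fun t _ _ => by positivity
  pos := fun t _ _ => by positivity
  lt := fun t h0 h1 => by nlinarith
  deriv := fun t _ _ => by simpa using hasDerivAt_pow 2 t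
  omeq := fun x hx t h0 h1 => by
    have : 1 - t ≠ 0 := by linarith
    have : 1 + t ≠ 0 := by linarith
    have : 1 - t ^ 2 ≠ 0 := by nlinarith
    cases x with
    | a => simp [om, mSQ]; field_simp
    | b => exact absurd rfl hx
    | c => simp [om, mSQ]; field_simp; ring
  na := fun x hx q hq => by
    cases x with
    | a => exact absurd rfl hx
    | b => simp [mSQ] at hq
    | c => simp [mSQ] at hq; rcases hq with rfl | rfl <;> simp

lemma SbHALF : Sb mHALF (fun t => t / (1 + t)) (fun t => 1 / (1 + t) ^ 2) where
  zero := by norm_num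
  cont := fun t h0 h1 => by
    have : 1 + t ≠ 0 := by linarith
    fun_prop (disch := assumption)
  nonneg := fun t _ _ => by positivity
  pos := fun t _ _ => by positivity
  lt := fun t h0 h1 => by rw [div_lt_one (by positivity)]; linarith
  deriv := fun t h0 _ => by
    have h : 1 + t ≠ 0 := by linarith
    have := (hasDerivAt_id t).div ((hasDerivAt_id t).const_add 1) h
    refine this.congr_deriv ?_
    simp
  omeq := fun x hx t h0 h1 => by
    have : 1 + t ≠ 0 := by linarith
    have : 1 - t / (1 + t) ≠ 0 := by
      have : 1 - t / (1 + t) = 1 / (1 + t) := by field_simp; ring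
      rw [this]; positivity
    cases x with
    | a => simp [om, mHALF]; field_simp; ring
    | b => exact absurd rfl hx
    | c =>
      have : 1 - t / (1 + t) = 1 / (1 + t) := by field_simp; ring
      simp only [om, mHALF, this]; simp; field_simp
  na := fun x hx q hq => by
    cases x with
    | a => exact absurd rfl hx
    | b => simp [mHALF] at hq
    | c => simp [mHALF] at hq; rcases hq with rfl | rfl <;> simp

lemma SbPHI : Sb mPHI (fun t => 4 * t / (1 + t) ^ 2) (fun t => 4 * (1 - t) / (1 + t) ^ 3) where
  zero := by norm_num
  cont := fun t h0 h1 => by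
    have : (1 + t) ^ 2 ≠ 0 := by positivity
    fun_prop (disch := assumption)
  nonneg := fun t _ _ => by positivity
  pos := fun t _ _ => by positivity
  lt := fun t h0 h1 => by rw [div_lt_one (by positivity)]; nlinarith [sq_pos_of_pos (sub_pos.2 h1)]
  deriv := fun t h0 _ => by
    have h : (1 + t) ^ 2 ≠ 0 := by positivity
    have := ((hasDerivAt_id t).const_mul 4).div (((hasDerivAt_id t).const_add 1).pow 2) h
    refine this.congr_deriv ?_
    have h : (1 + t) ≠ 0 := by positivity
    simp; field_simp; ring
  omeq := fun x hx t h0 h1 => by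
    have : 1 + t ≠ 0 := by linarith
    have h1' : 1 - t ≠ 0 := by linarith
    cases x with
    | a => simp [om, mPHI]; field_simp; ring
    | b => exact absurd rfl hx
    | c =>
      have : 1 - 4 * t / (1 + t) ^ 2 = (1 - t) ^ 2 / (1 + t) ^ 2 := by field_simp; ring
      simp only [om, mPHI, this]; simp; field_simp; ring
  na := fun x hx q hq => by
    cases x with
    | a => exact absurd rfl hx
    | b => simp [mPHI] at hq
    | c => simp [mPHI] at hq; rcases hq with rfl | rfl <;> simp

theorem sqZ (w : List Lt) (gw : good w) (bw : noB w) (hw : okw w) (hs : ∀ p ∈ sub mSQ w, okw p.2) :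
    Z w = LZ (sub mSQ w) := by
  have h2 := tendsto_LI (sub mSQ w) (fun p hp => Cv_ok (hs p hp))
  have hsq : Tendsto (fun t : ℝ => t ^ 2) (𝓝[<] 1) (𝓝[<] 1) := by
    refine tendsto_nhdsWithin_iff.2 ⟨?_, ?_⟩
    · have : ContinuousAt (fun t : ℝ => t ^ 2) 1 := by fun_prop
      have h := this.tendsto
      norm_num at h
      exact h.mono_left nhdsWithin_le_nhds
    · filter_upwards [Ioo_mem_lt] with t ht
      exact SbSQ.lt t ht.1.le ht.2
  have h1 := (Cv_ok hw).2.comp hsq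
  refine tendsto_nhds_unique h1 (h2.congr' ?_)
  filter_upwards [Ioo_mem_lt] with t ht
  exact (subst SbSQ w gw bw t ht.1.le ht.2).symm

theorem halfZ (w : List Lt) (gw : good w) (bw : noB w) (hs : ∀ p ∈ sub mHALF w, okw p.2) :
    I w (1/2) = LZ (sub mHALF w) := by
  have h2 := tendsto_LI (sub mHALF w) (fun p hp => Cv_ok (hs p hp))
  have h1 : Tendsto (fun t : ℝ => I w (t / (1 + t))) (𝓝[<] 1) (𝓝 (I w (1/2))) := by
    have hc : ContinuousAt (I w) (1/2) := continuousAt_I w (by norm_num [abs_of_pos])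
    have h2 : ContinuousAt (fun t : ℝ => t / (1 + t)) 1 := by
      have : (1:ℝ) + 1 ≠ 0 := by norm_num
      fun_prop (disch := assumption)
    have h3 := h2.tendsto
    norm_num at h3
    exact hc.tendsto.comp ((by norm_num; exact h3 : Tendsto (fun t : ℝ => t / (1 + t)) (𝓝 1) (𝓝 (1/2))).mono_left nhdsWithin_le_nhds)
  refine tendsto_nhds_unique h1 (h2.congr' ?_)
  filter_upwards [Ioo_mem_lt] with t ht
  exact (subst SbHALF w gw bw t ht.1.le ht.2).symm


end AZ

open Real
namespace AZ
open Lt Filter Topology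

def sg : Bool → ℝ
  | true => 1
  | false => -1

lemma sg_mul (e f : Bool) : sg (e == f) = sg e * sg f := by cases e <;> cases f <;> simp [sg]
lemma sg_sq (e : Bool) : sg e * sg e = 1 := by cases e <;> simp [sg]
lemma sg_abs (e : Bool) : |sg e| = 1 := by cases e <;> simp [sg]

noncomputable def ut (x : ℕ × Bool) (n : ℕ) : ℝ := sg x.2 ^ n / (n : ℝ) ^ (x.1 + 1)

def adx (x y : ℕ × Bool) : ℕ × Bool := (x.1 + y.1 + 1, x.2 == y.2)

lemma ut_adx (x y : ℕ × Bool) (n : ℕ) : ut (adx x y) n = ut x n * ut y n := by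
  simp only [ut, adx, sg_mul]
  rw [mul_pow, div_mul_div_comm, ← pow_add]
  congr 2; ring

noncomputable def Q : List (ℕ × Bool) → ℕ → ℝ
  | [], _ => 1
  | x :: r, N => ∑ k ∈ Finset.range N, ut x (k+1) * Q r k

def ins (x : ℕ × Bool) : List (ℕ × Bool) → List (List (ℕ × Bool))
  | [] => [[x]]
  | y :: r => (x :: y :: r) :: (adx x y :: r) :: (ins x r).map (List.cons y)

def insR (x y : ℕ × Bool) (r : List (ℕ × Bool)) : List (List (ℕ × Bool)) :=
  (adx x y :: r) :: (ins x r).map (List.cons y)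

noncomputable def SQ (L : List (List (ℕ × Bool))) (N : ℕ) : ℝ := (L.map (fun r => Q r N)).sum

lemma Q_succ (x : ℕ × Bool) (r : List (ℕ × Bool)) (N : ℕ) : Q (x :: r) (N+1) = Q (x :: r) N + ut x (N+1) * Q r N := by
  simp only [Q]; rw [Finset.sum_range_succ]

lemma SQ_succ (y : ℕ × Bool) (L : List (List (ℕ × Bool))) (N : ℕ) :
    SQ (L.map (List.cons y)) (N+1) = SQ (L.map (List.cons y)) N + ut y (N+1) * SQ L N := by
  induction L with
  | nil => simp [SQ]
  | cons r L ih =>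
    simp only [SQ, List.map_cons, List.sum_cons] at ih ⊢
    rw [ih, Q_succ]; ring

lemma SQ_zero (y : ℕ × Bool) (L : List (List (ℕ × Bool))) : SQ (L.map (List.cons y)) 0 = 0 := by
  induction L with
  | nil => simp [SQ]
  | cons r L ih =>
    simp only [SQ, List.map_cons, List.sum_cons] at ih ⊢
    rw [ih]; simp [Q]

lemma stuffle (x : ℕ × Bool) (r : List (ℕ × Bool)) (N : ℕ) : Q [x] N * Q r N = SQ (ins x r) N := by
  induction r generalizing N with
  | nil => simp [ins, SQ, Q]
  | cons y r ih =>
    induction N with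
    | zero =>
      have h := SQ_zero y (ins x r)
      simp only [SQ] at h
      simp only [ins, SQ, List.map_cons, List.sum_cons, h]; simp [Q]
    | succ N ihN =>
      have h := SQ_succ y (ins x r) N
      simp only [SQ] at h
      have ih' := ih N
      simp only [ins, SQ, List.map_cons, List.sum_cons] at ihN ih' ⊢
      rw [h, Q_succ, Q_succ, Q_succ, Q_succ, ut_adx, ← ih']
      have : Q [] N = 1 := rfl
      rw [this]
      linear_combination ihN

lemma insR_step (x y : ℕ × Bool) (r : List (ℕ × Bool)) (N : ℕ) :
    SQ (insR x y r) (N+1) = SQ (insR x y r) N + Q [x] (N+1) * (ut y (N+1) * Q r N) := by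
  have h := SQ_succ y (ins x r) N
  have h2 := stuffle x r N
  simp only [SQ] at h h2
  simp only [insR, SQ, List.map_cons, List.sum_cons]
  rw [h, Q_succ, Q_succ, ut_adx, ← h2]
  have : Q [] N = 1 := rfl
  rw [this]; ring

def lett : Bool → Lt
  | true => Lt.c
  | false => Lt.b

def wordOf : Bool → List (ℕ × Bool) → List Lt
  | _, [] => []
  | p, x :: r => List.replicate x.1 Lt.a ++ (lett (p == x.2) :: wordOf (p == x.2) r)

def sgn : Bool → List (ℕ × Bool) → ℝ
  | _, [] => 1
  | p, x :: r => sg (p == x.2) * sgn (p == x.2) r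

lemma sgn_sq (p : Bool) (r : List (ℕ × Bool)) : sgn p r * sgn p r = 1 := by
  induction r generalizing p with
  | nil => simp [sgn]
  | cons x r ih =>
    simp only [sgn]
    have := ih (p == x.2)
    have h2 := sg_sq (p == x.2)
    linear_combination h2 * sgn (p == x.2) r * sgn (p == x.2) r + this

lemma co_rep (s : ℕ) (w : List Lt) (n : ℕ) : co (List.replicate s Lt.a ++ w) n = co w n / (n : ℝ) ^ s := by
  induction s with
  | zero => simp
  | succ s ih => 
    rw [List.replicate_succ, List.cons_append]
    simp only [co]
    rw [ih, div_div, pow_succ]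

lemma co_lett (p : Bool) (w : List Lt) (n : ℕ) :
    co (lett p :: w) n = sg p * sg p ^ n * (∑ k ∈ Finset.range n, sg p ^ k * co w k) / n := by
  cases p
  · simp only [lett, co, sg]; ring
  · simp only [lett, co, sg]; simp

lemma sg_pow_sq (p : Bool) (k : ℕ) : sg p ^ k * sg p ^ k = 1 := by rw [← mul_pow, sg_sq, one_pow]

lemma co_wordOf (r : List (ℕ × Bool)) : ∀ (p : Bool) (x : ℕ × Bool) (k : ℕ), 
    co (wordOf p (x :: r)) (k+1) = sgn p (x :: r) * sg p ^ (k+1) * (ut x (k+1) * Q r k) := by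
  induction r with
  | nil =>
    intro p x k
    simp only [wordOf, co_rep, co_lett, sgn, Q]
    have : ∑ k ∈ Finset.range (k+1), sg (p == x.2) ^ k * co [] k = 1 := by
      rw [Finset.sum_range_succ']; simp [co]
    rw [this, ut, sg_mul, mul_pow]
    have h : ((k + 1 : ℕ) : ℝ) ≠ 0 := by positivity
    rw [pow_succ ((k + 1 : ℕ) : ℝ)]
    field_simp
  | cons y r ih =>
    intro p x k
    rw [wordOf, co_rep, co_lett]
    have : ∑ j ∈ Finset.range (k+1), sg (p == x.2) ^ j * co (wordOf (p == x.2) (y :: r)) j 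
        = sgn (p == x.2) (y :: r) * Q (y :: r) k := by
      rw [Finset.sum_range_succ']
      have h0 : co (wordOf (p == x.2) (y :: r)) 0 = 0 := co_zero' (by simp [wordOf])
      rw [h0, mul_zero, add_zero, Q, Finset.mul_sum]
      refine Finset.sum_congr rfl fun j _ => ?_
      rw [ih]
      have := sg_pow_sq (p == x.2) (j+1)
      linear_combination (sgn (p == x.2) (y :: r) * (ut y (j + 1) * Q r j)) * this
    rw [this]
    have e : sgn p (x :: y :: r) = sg (p == x.2) * sgn (p == x.2) (y :: r) := rfl
    rw [e, ut, sg_mul, mul_pow]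
    have h : ((k + 1 : ℕ) : ℝ) ≠ 0 := by positivity
    rw [pow_succ ((k + 1 : ℕ) : ℝ)]
    field_simp

lemma sum_co (x : ℕ × Bool) (r : List (ℕ × Bool)) (N : ℕ) :
    ∑ n ∈ Finset.range (N+1), co (wordOf true (x :: r)) n = sgn true (x :: r) * Q (x :: r) N := by
  rw [Finset.sum_range_succ', co_zero' (by simp [wordOf]), add_zero, Q, Finset.mul_sum]
  refine Finset.sum_congr rfl fun j _ => ?_
  rw [co_wordOf]; simp [sg]

noncomputable def Y (r : List (ℕ × Bool)) : ℝ := sgn true r * Z (wordOf true r)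

noncomputable def SY (L : List (List (ℕ × Bool))) : ℝ := (L.map Y).sum

lemma Y_eq {x : ℕ × Bool} {r : List (ℕ × Bool)} {l : ℝ} (h : Tendsto (Q (x :: r)) atTop (𝓝 l)) : Y (x :: r) = l := by
  have h1 : Tendsto (fun n => ∑ i ∈ Finset.range n, co (wordOf true (x :: r)) i) atTop (𝓝 (sgn true (x :: r) * l)) := by
    rw [← tendsto_add_atTop_iff_nat 1]
    simp only [sum_co]
    exact h.const_mul _
  rw [Y, Z_eq (Abel h1), ← mul_assoc, sgn_sq, one_mul]

lemma Q_tendsto (s : ℕ) (e : Bool) (r : List (ℕ × Bool)) : Tendsto (Q ((s+1,e) :: r)) atTop (𝓝 (Y ((s+1,e) :: r))) := by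
  have hs : Summable (co (wordOf true ((s+1,e) :: r))) := by
    simp only [wordOf, List.replicate_succ, List.cons_append]
    exact (summable_co_a _).of_abs
  have h := hs.hasSum.tendsto_sum_nat
  rw [← tendsto_add_atTop_iff_nat 1] at h
  simp only [sum_co] at h
  have h2 := h.const_mul (sgn true ((s+1,e) :: r))
  simp only [← mul_assoc, sgn_sq, one_mul] at h2
  rwa [← Y_eq h2] at h2

lemma Q_tendsto' (x : ℕ × Bool) (hx : x.1 ≠ 0) (r : List (ℕ × Bool)) : Tendsto (Q (x :: r)) atTop (𝓝 (Y (x :: r))) := by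
  obtain ⟨s, e⟩ := x
  obtain ⟨s, rfl⟩ := Nat.exists_eq_succ_of_ne_zero hx
  exact Q_tendsto s e r

lemma SQ_tendsto (y : ℕ × Bool) (hy : y.1 ≠ 0) (L : List (List (ℕ × Bool))) :
    Tendsto (SQ (L.map (List.cons y))) atTop (𝓝 (SY (L.map (List.cons y)))) := by
  induction L with
  | nil =>
    have : SQ (List.map (List.cons y) []) = fun _ => 0 := by ext; simp [SQ]
    rw [this]; simp only [SY, List.map_nil, List.sum_nil]; exact tendsto_const_nhds
  | cons r L ih =>
    have : SQ (List.map (List.cons y) (r :: L)) = fun N => Q (y :: r) N + SQ (L.map (List.cons y)) N := by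
      ext; simp [SQ]
    rw [this]
    have e : SY (List.map (List.cons y) (r :: L)) = Y (y :: r) + SY (L.map (List.cons y)) := by simp [SY]
    rw [e]
    exact (Q_tendsto' y hy r).add ih

lemma insR_tendsto (x y : ℕ × Bool) (hy : y.1 ≠ 0) (r : List (ℕ × Bool)) :
    Tendsto (SQ (insR x y r)) atTop (𝓝 (SY (insR x y r))) := by
  have : SQ (insR x y r) = fun N => Q (adx x y :: r) N + SQ ((ins x r).map (List.cons y)) N := by
    ext; simp [SQ, insR]
  rw [this]
  have e : SY (insR x y r) = Y (adx x y :: r) + SY ((ins x r).map (List.cons y)) := by simp [SY, insR]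
  rw [e]
  exact (Q_tendsto' _ (by simp [adx]) r).add (SQ_tendsto y hy _)

theorem stZ (x y : ℕ × Bool) (r : List (ℕ × Bool)) (hx : Tendsto (Q [x]) atTop (𝓝 (Y [x]))) (hy : y.1 ≠ 0) :
    Y [x] * Y (y :: r) = SY (ins x (y :: r)) := by
  have h1 := (hx.mul (Q_tendsto' y hy r)).sub (insR_tendsto x y hy r)
  have h2 : Tendsto (Q (x :: y :: r)) atTop (𝓝 (Y [x] * Y (y :: r) - SY (insR x y r))) := by
    refine h1.congr fun N => ?_
    rw [stuffle]; simp [SQ, ins, insR]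
  have h3 := Y_eq h2
  have e : SY (ins x (y :: r)) = Y (x :: y :: r) + SY (insR x y r) := by simp [SY, ins, insR]
  rw [e, h3]; ring

end AZ

open Real
namespace AZ
open Lt Filter Topology

noncomputable def Hn (k : ℕ) : ℝ := ∑ j ∈ Finset.range k, 1 / (j + 1 : ℝ)

lemma Hn_le (k : ℕ) : Hn k ≤ 4 * qr k := by
  refine le_trans (Finset.sum_le_sum fun j _ => ?_) (sum_qr k)
  have h1 := one_le_qr (Nat.succ_pos j)
  have h4 := qr_pow (j+1)
  simp only [Nat.succ_eq_add_one] at h1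
  push_cast at h4
  rw [← h4]
  apply one_div_le_one_div_of_le (by positivity)
  exact pow_le_pow_right₀ h1 (by norm_num)

lemma Hn_nonneg (k : ℕ) : 0 ≤ Hn k := Finset.sum_nonneg fun j _ => by positivity

lemma co_c (n : ℕ) : co [Lt.c] n = 1 / n := by
  rcases n with _ | n
  · simp [co]
  · simp only [co]; rw [Finset.sum_range_succ']; simp

lemma I_c {t : ℝ} (ht : |t| < 1) : I [Lt.c] t = - Real.log (1 - t) := by
  rw [← (Real.hasSum_pow_div_log_of_abs_lt_one ht).tsum_eq, I, (summable_I [Lt.c] ht).tsum_eq_zero_add]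
  simp only [co_c]
  simp
  congr 1; ext n; ring

/-- tail of the logarithm series -/
noncomputable def Tk (k : ℕ) (t : ℝ) : ℝ := ∑' n : ℕ, if k < n then t ^ n / n else 0

lemma summable_tn {t : ℝ} (h0 : 0 ≤ t) (h1 : t < 1) : Summable (fun n : ℕ => t ^ n / n) := by
  refine (summable_I [Lt.c] (t := t) (by rwa [abs_of_nonneg h0])).congr fun n => ?_
  rw [co_c]; ring

lemma I_c' (t : ℝ) : I [Lt.c] t = ∑' n : ℕ, t ^ n / n := by
  unfold I; congr 1; ext n; rw [co_c]; ring

lemma summable_Tk (k : ℕ) {t : ℝ} (h0 : 0 ≤ t) (h1 : t < 1) :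
    Summable (fun n : ℕ => if k < n then t ^ n / n else 0) := by
  refine Summable.of_nonneg_of_le (fun n => ?_) (fun n => ?_) (summable_tn h0 h1)
  · split_ifs <;> positivity
  · split_ifs
    · exact le_rfl
    · positivity

lemma Tk_eq (k : ℕ) {t : ℝ} (h0 : 0 ≤ t) (h1 : t < 1) :
    I [Lt.c] t - Tk k t = ∑ j ∈ Finset.range k, t ^ (j+1) / (j + 1 : ℝ) := by
  rw [I_c', Tk, ← (summable_tn h0 h1).tsum_sub (summable_Tk k h0 h1), tsum_eq_sum (s := Finset.range (k+1))]
  · rw [Finset.sum_range_succ']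
    simp only [Nat.cast_zero, div_zero]
    rw [if_neg (by omega), sub_zero, add_zero]
    apply Finset.sum_congr rfl
    intro j hj
    rw [Finset.mem_range] at hj
    rw [if_neg (by omega)]; simp
  · intro n hn
    rw [Finset.mem_range] at hn
    rw [if_pos (by omega), sub_self]

lemma Tk_le (k : ℕ) {t : ℝ} (h0 : 0 ≤ t) (h1 : t < 1) : Tk k t ≤ t ^ k * I [Lt.c] t := by
  have hs := summable_Tk k h0 h1
  have e : Tk k t = ∑' n : ℕ, t ^ (n + (k+1)) / ((n + (k+1) : ℕ) : ℝ) := by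
    rw [Tk, ← hs.sum_add_tsum_nat_add (k+1), Finset.sum_eq_zero, zero_add]
    · congr 1; ext n; rw [if_pos (by omega)]
    · intro n hn; rw [Finset.mem_range] at hn; rw [if_neg (by omega)]
  rw [e, I_c', ← (summable_tn h0 h1).sum_add_tsum_nat_add 1]
  simp only [Finset.range_one, Finset.sum_singleton, Nat.cast_zero, div_zero, zero_add]
  rw [← tsum_mul_left]
  refine Summable.tsum_le_tsum (fun n => ?_) ((summable_nat_add_iff (k+1)).2 (summable_tn h0 h1))
    (((summable_nat_add_iff 1).2 (summable_tn h0 h1)).mul_left _)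
  rw [← mul_div_assoc, ← pow_add]
  have : t ^ (n + (k+1)) = t ^ (k + (n+1)) := by congr 1; ring
  rw [this]
  gcongr; omega

noncomputable def hk (k : ℕ) (t : ℝ) : ℝ := t ^ k * I [Lt.c] t - Tk k t

lemma Tk_nonneg (k : ℕ) {t : ℝ} (h0 : 0 ≤ t) : 0 ≤ Tk k t :=
  tsum_nonneg fun n => by split_ifs <;> positivity

lemma I_c_nonneg {t : ℝ} (h0 : 0 ≤ t) : 0 ≤ I [Lt.c] t := by
  rw [I_c']; exact tsum_nonneg fun n => by positivity

lemma hk_abs (k : ℕ) {t : ℝ} (h0 : 0 ≤ t) (h1 : t < 1) : |hk k t| ≤ Hn k := by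
  have h := Tk_le k h0 h1
  rw [hk, abs_of_nonneg (by linarith)]
  have h2 : t ^ k * I [Lt.c] t ≤ I [Lt.c] t := mul_le_of_le_one_left (I_c_nonneg h0) (pow_le_one₀ h0 h1.le)
  have h3 := Tk_eq k h0 h1
  have h4 : ∑ j ∈ Finset.range k, t ^ (j+1) / (j + 1 : ℝ) ≤ Hn k :=
    Finset.sum_le_sum fun j _ => by gcongr; exact pow_le_one₀ h0 h1.le
  linarith

lemma hk_tendsto (k : ℕ) : Tendsto (hk k) (𝓝[<] (1:ℝ)) (𝓝 (Hn k)) := by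
  have e : ∀ t ∈ Set.Ioo (0:ℝ) 1, hk k t = (∑ j ∈ Finset.range k, t ^ (j+1) / (j + 1 : ℝ)) -
      (∑ j ∈ Finset.range k, t ^ j) * Real.negMulLog (1 - t) := by
    intro t ht
    rw [← Tk_eq k ht.1.le ht.2, hk, I_c (by rw [abs_of_pos ht.1]; exact ht.2), Real.negMulLog]
    have := geom_sum_mul t k
    linear_combination (Real.log (1 - t)) * this
  have hc : Continuous (fun t : ℝ => (∑ j ∈ Finset.range k, t ^ (j+1) / (j + 1 : ℝ)) -
      (∑ j ∈ Finset.range k, t ^ j) * Real.negMulLog (1 - t)) := by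
    have := Real.continuous_negMulLog
    fun_prop
  have h1 := (hc.tendsto 1).mono_left (nhdsWithin_le_nhds (s := Set.Iio 1))
  have h2 := h1.congr' (f₂ := hk k) (by
    filter_upwards [Ioo_mem_lt] with t ht
    exact (e t ht).symm)
  convert h2 using 2
  simp [Hn]

lemma reg_series (v : List Lt) {t : ℝ} (h0 : 0 ≤ t) (h1 : t < 1) :
    I [Lt.c] t * I (Lt.a :: v) t - I (Lt.c :: Lt.a :: v) t = ∑' k, co (Lt.a :: v) k * hk k t := by
  have ht : |t| < 1 := by rwa [abs_of_nonneg h0]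
  set f := co (Lt.a :: v) with hf
  have hsf := summable_co_a v
  let G : ℕ → ℕ → ℝ := fun k n => if k < n then f k * (t ^ n / n) else 0
  have hG : Summable (Function.uncurry G) := by
    have hp : Summable (fun x : ℕ × ℕ => |f x.1| * (t ^ x.2 / x.2)) :=
      hsf.mul_of_nonneg (summable_tn h0 h1) (fun n => abs_nonneg _) (fun n => by positivity)
    refine Summable.of_norm_bounded hp ?_
    rintro ⟨k, n⟩
    simp only [Function.uncurry, G]
    split_ifs
    · rw [Real.norm_eq_abs, abs_mul, abs_of_nonneg (by positivity : (0:ℝ) ≤ t ^ n / n)]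
    · simp; positivity
  have hcomm := hG.tsum_comm
  have e1 : ∀ k, ∑' n, G k n = f k * Tk k t := by
    intro k
    rw [Tk, ← tsum_mul_left]
    congr 1; ext n; simp only [G]; split_ifs <;> simp
  have e2 : ∀ n, ∑' k, G k n = co (Lt.c :: Lt.a :: v) n * t ^ n := by
    intro n
    rw [tsum_eq_sum (s := Finset.range n)]
    · simp only [co]
      rw [div_mul_eq_mul_div, Finset.sum_mul, Finset.sum_div]
      refine Finset.sum_congr rfl fun k hk => ?_
      rw [Finset.mem_range] at hk
      simp only [G, if_pos hk, hf, co]; ring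
    · intro k hk
      rw [Finset.mem_range] at hk
      simp only [G, if_neg hk]
  have hsk : Summable (fun k => f k * Tk k t) := by
    have := hG.prod
    simp only [Function.uncurry] at this
    exact this.congr e1
  simp only [e1, e2] at hcomm
  have e3 : I (Lt.c :: Lt.a :: v) t = ∑' k, f k * Tk k t := hcomm
  have hsI := summable_I (Lt.a :: v) ht
  rw [e3]
  have e4 : I [Lt.c] t * I (Lt.a :: v) t = ∑' k, I [Lt.c] t * (f k * t ^ k) := by
    rw [tsum_mul_left]; rfl
  rw [e4, ← (hsI.mul_left _).tsum_sub hsk]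
  congr 1; ext k; rw [hk]; ring

lemma reg_sum (v : List Lt) (gv : good (Lt.a :: v)) :
    SZ ((sh [Lt.c] v).map (List.cons Lt.a)) = ∑' k, co (Lt.a :: v) k * Hn k := by
  have hd : Tendsto (fun t => ∑' k, co (Lt.a :: v) k * hk k t) (𝓝[<] (1:ℝ)) (𝓝 (∑' k, co (Lt.a :: v) k * Hn k)) := by
    refine tendsto_tsum_of_dominated_convergence (bound := fun k => 4 * (|co (Lt.a :: v) k| * qr k))
      ((summable_co_a' v).mul_left 4) (fun k => (hk_tendsto k).const_mul _) ?_
    filter_upwards [Ioo_mem_lt] with t ht k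
    rw [Real.norm_eq_abs, abs_mul]
    have h1 := hk_abs k ht.1.le ht.2
    have h2 := Hn_le k
    nlinarith [abs_nonneg (co (Lt.a :: v) k), mul_le_mul_of_nonneg_left (h1.trans h2) (abs_nonneg (co (Lt.a :: v) k))]
  have hl := tendsto_SI ((sh [Lt.c] v).map (List.cons Lt.a)) (fun w hw => by
    obtain ⟨w', _, rfl⟩ := List.mem_map.1 hw
    exact Cv_a w')
  refine tendsto_nhds_unique hl (hd.congr' ?_)
  filter_upwards [Ioo_mem_lt] with t ht
  rw [← reg_series v ht.1.le ht.2, shuffle _ [Lt.c] (Lt.a :: v) rfl (by simp [good]) gv t ht.1.le ht.2]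
  simp [sh, SI]

theorem regZ (s : ℕ) (e : Bool) (r : List (ℕ × Bool)) (v : List Lt) (hv : wordOf true ((s+1, e) :: r) = Lt.a :: v)
    (gv : good (Lt.a :: v)) :
    SZ ((sh [Lt.c] v).map (List.cons Lt.a)) = sgn true ((s+1, e) :: r) * SY (insR (0, true) (s+1, e) r) := by
  rw [reg_sum v gv]
  have hs : Summable (fun k => co (Lt.a :: v) k * Hn k) := by
    refine Summable.of_norm_bounded ((summable_co_a' v).mul_left 4) fun k => ?_
    rw [Real.norm_eq_abs, abs_mul, abs_of_nonneg (Hn_nonneg k)]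
    have h2 := Hn_le k
    nlinarith [mul_le_mul_of_nonneg_left h2 (abs_nonneg (co (Lt.a :: v) k))]
  have h1 := hs.hasSum.tendsto_sum_nat
  rw [← tendsto_add_atTop_iff_nat 1] at h1
  have h2 := (insR_tendsto (0, true) (s+1, e) (by simp) r).const_mul (sgn true ((s+1, e) :: r))
  refine tendsto_nhds_unique h1 (h2.congr fun N => ?_)
  induction N with
  | zero =>
    have h := SQ_zero (s+1, e) (ins (0, true) r)
    simp only [SQ] at h
    simp only [insR, SQ, List.map_cons, List.sum_cons, h]
    simp [Q, co_zero]
  | succ N ih =>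
    rw [Finset.sum_range_succ, ← ih, insR_step, ← hv, co_wordOf]
    have : Q [(0, true)] (N+1) = Hn (N+1) := by simp [Q, Hn, ut, sg]
    rw [this]; simp only [sg]; ring

end AZ

open Real
namespace AZ
open Lt Filter Topology

/-! base values -/

lemma Q_b_tendsto : Tendsto (Q [(0, false)]) atTop (𝓝 (Y [(0, false)])) := by
  have hf : Antitone (fun n : ℕ => 1 / ((n : ℝ) + 1)) := by
    intro m n h
    have : (m : ℝ) ≤ n := by exact_mod_cast h
    simp only
    gcongr
  obtain ⟨l, hl⟩ := hf.tendsto_alternating_series_of_tendsto_zero tendsto_one_div_add_atTop_nhds_zero_nat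
  have h2 : Tendsto (Q [(0, false)]) atTop (𝓝 (-l)) := by
    refine hl.neg.congr fun N => ?_
    simp only [Q, ut, sg]
    rw [← Finset.sum_neg_distrib]
    refine Finset.sum_congr rfl fun k _ => ?_
    push_cast; ring
  rwa [← Y_eq h2] at h2

lemma I_b {t : ℝ} (h0 : 0 ≤ t) (h1 : t < 1) : I [Lt.b] t = Real.log (1 + t) := by
  refine eq_of_deriv (f := I [Lt.b]) (g := fun t => Real.log (1 + t)) (f' := fun t => 1 / (1 + t)) ?_ ?_ ?_ ?_ ?_ h0 h1
  · simp [I_zero]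
  · intro t h0 h1; exact continuousAt_I _ (by rwa [abs_of_nonneg h0])
  · intro t h0 h1
    have : 1 + t ≠ 0 := by positivity
    fun_prop (disch := assumption)
  · intro t h0 h1
    have := hasDerivAt_I Lt.b [] (by simp) h0 h1
    simpa [om, I_nil] using this
  · intro t h0 h1
    have h : 1 + t ≠ 0 := by positivity
    exact ((hasDerivAt_id t).const_add 1).log h

lemma Z_b : Z [Lt.b] = Real.log 2 := by
  apply Z_eq
  have hc : ContinuousAt (fun t : ℝ => Real.log (1 + t)) 1 := by
    have : (1:ℝ) + 1 ≠ 0 := by norm_num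
    fun_prop (disch := assumption)
  have h := hc.tendsto.mono_left (nhdsWithin_le_nhds (s := Set.Iio 1))
  norm_num at h
  refine h.congr' ?_
  filter_upwards [Ioo_mem_lt] with t ht
  exact (I_b ht.1.le ht.2).symm

lemma Z_zeta (s : ℕ) : Z (Lt.a :: (List.replicate s Lt.a ++ [Lt.c])) = zetaVal (s+2) := by
  rw [Z_a, (summable_co_a _).of_abs.tsum_eq_zero_add, co_zero, zero_add, zetaVal]
  congr 1; ext n
  simp only [co]
  rw [co_rep, co_c, div_div, div_div]
  push_cast; ring_nf

lemma Z_ac : Z [Lt.a, Lt.c] = zetaVal 2 := Z_zeta 0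
lemma Z_aac : Z [Lt.a, Lt.a, Lt.c] = zetaVal 3 := Z_zeta 1
lemma Z_aaaac : Z [Lt.a, Lt.a, Lt.a, Lt.a, Lt.c] = zetaVal 5 := Z_zeta 3

lemma zetaVal_four : zetaVal 4 = 2 / 5 * zetaVal 2 ^ 2 := by
  have h2 : zetaVal 2 = π ^ 2 / 6 := by
    rw [zetaVal, ← hasSum_zeta_two.tsum_eq, hasSum_zeta_two.summable.tsum_eq_zero_add]
    simp
  have h4 : zetaVal 4 = π ^ 4 / 90 := by
    rw [zetaVal, ← hasSum_zeta_four.tsum_eq, hasSum_zeta_four.summable.tsum_eq_zero_add]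
    simp
  rw [h2, h4]; ring

lemma polyLog_half : polyLog 5 (1/2) = I [Lt.a, Lt.a, Lt.a, Lt.a, Lt.c] (1/2) := by
  rw [I, (summable_I _ (by norm_num [abs_of_pos])).tsum_eq_zero_add, co_zero, zero_mul, zero_add, polyLog]
  congr 1; ext n
  have := co_rep 4 [Lt.c] (n+1)
  simp only [List.replicate, List.cons_append, List.nil_append] at this
  rw [this, co_c, div_div]
  push_cast
  field_simp

/-! the series as a combination of words -/

lemma wk_int (k : ℕ) : ∫ s in (0:ℝ)..1, (1 - s ^ 2) ^ k = 4 ^ (k+1) / (2 * ((k + 1 : ℝ) * (Nat.choose (2 * (k+1)) (k+1) : ℝ))) := by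
  induction k with
  | zero => norm_num
  | succ k ih =>
    have hd : ∀ s : ℝ, HasDerivAt (fun s : ℝ => s * (1 - s ^ 2) ^ (k+1))
        ((2 * (k:ℝ) + 3) * (1 - s ^ 2) ^ (k+1) - (2 * (k:ℝ) + 2) * (1 - s ^ 2) ^ k) s := by
      intro s
      have := (hasDerivAt_id s).mul ((((hasDerivAt_id s).pow 2).const_sub 1).pow (k+1))
      refine this.congr_deriv ?_
      simp [pow_succ]; ring
    have hi := intervalIntegral.integral_eq_sub_of_hasDerivAt (a := 0) (b := 1) (fun s _ => hd s)
      (Continuous.intervalIntegrable (by fun_prop) _ _)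
    rw [intervalIntegral.integral_sub (Continuous.intervalIntegrable (by fun_prop) _ _)
      (Continuous.intervalIntegrable (by fun_prop) _ _), intervalIntegral.integral_const_mul,
      intervalIntegral.integral_const_mul, ih] at hi
    have hc := Nat.succ_mul_centralBinom_succ (k+1)
    simp only [Nat.centralBinom] at hc
    have hc' : ((k:ℝ) + 2) * (Nat.choose (2 * (k+1+1)) (k+1+1) : ℝ) = 2 * (2 * (k + 1) + 1) * (Nat.choose (2 * (k+1)) (k+1) : ℝ) := by
      have h : ((((k + 1 + 1) * (2 * (k + 1 + 1)).choose (k + 1 + 1) : ℕ)) : ℝ) =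
        ((2 * (2 * (k + 1) + 1) * (2 * (k + 1)).choose (k + 1) : ℕ) : ℝ) := by exact_mod_cast hc
      push_cast at h
      linear_combination h
    have hp : (Nat.choose (2 * (k+1)) (k+1) : ℝ) ≠ 0 := by
      have := Nat.choose_pos (n := 2 * (k+1)) (k := k+1) (by omega)
      positivity
    push_cast
    have e : ((k:ℝ) + 1 + 1) * (Nat.choose (2 * (k+1+1)) (k+1+1) : ℝ) = 2 * (2 * (k + 1) + 1) * (Nat.choose (2 * (k+1)) (k+1) : ℝ) := by
      linear_combination hc'
    rw [e]
    have h3 : (2 * (k:ℝ) + 3) ≠ 0 := by positivity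
    have h4 : ∫ s in (0:ℝ)..1, (1 - s ^ 2) ^ (k+1) = (2 * (k:ℝ) + 2) * (4 ^ (k+1) / (2 * ((k + 1 : ℝ) * (Nat.choose (2 * (k+1)) (k+1) : ℝ)))) / (2 * k + 3) := by
      rw [eq_div_iff h3]
      simp at hi
      linear_combination hi
    rw [h4]
    have h5 : (2 * ((k:ℝ) + 1) + 1) ≠ 0 := by positivity
    have h6 : ((k:ℝ) + 1) ≠ 0 := by positivity
    field_simp
    ring

noncomputable def hc (k : ℕ) : ℝ := co [Lt.a, Lt.a, Lt.a, Lt.c] k + co [Lt.a, Lt.a, Lt.c, Lt.c] k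

lemma hc_succ (k : ℕ) : hc (k+1) = genHarmonic (k+1) 1 / (k + 1 : ℝ) ^ 3 := by
  have h : ∑ j ∈ Finset.range (k+1), co [Lt.c] j = ∑ j ∈ Finset.range k, 1 / (j + 1 : ℝ) := by
    rw [Finset.sum_range_succ', co_zero, add_zero]
    refine Finset.sum_congr rfl fun j _ => ?_
    rw [co_c]; push_cast; rfl
  have e1 : co [Lt.a, Lt.a, Lt.a, Lt.c] (k+1) = co [Lt.c] (k+1) / (k+1:ℕ) / (k+1:ℕ) / (k+1:ℕ) := by rfl
  have e2 : co [Lt.a, Lt.a, Lt.c, Lt.c] (k+1) = (∑ j ∈ Finset.range (k+1), co [Lt.c] j) / (k+1:ℕ) / (k+1:ℕ) / (k+1:ℕ) := by rfl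
  rw [hc, e1, e2, h, co_c, genHarmonic, Finset.sum_range_succ]
  push_cast
  simp only [pow_one]
  have : (k:ℝ) + 1 ≠ 0 := by positivity
  field_simp
  ring

lemma summable_hc : Summable (fun k => |hc k|) := by
  refine Summable.of_nonneg_of_le (fun _ => abs_nonneg _) (fun k => abs_add_le _ _)
    ((summable_co_a [Lt.a, Lt.a, Lt.c]).add (summable_co_a [Lt.a, Lt.c, Lt.c]))

noncomputable def fS (s : ℝ) : ℝ := ∑' k, 2 * hc (k+1) * (1 - s ^ 2) ^ k

lemma one_sub_sq_abs {s : ℝ} (h : s ∈ Set.Icc (0:ℝ) 1) : |1 - s ^ 2| ≤ 1 := by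
  rw [abs_le]; constructor <;> nlinarith [h.1, h.2]

lemma fS_bound {s : ℝ} (h : s ∈ Set.Icc (0:ℝ) 1) (k : ℕ) : ‖2 * hc (k+1) * (1 - s ^ 2) ^ k‖ ≤ 2 * |hc (k+1)| := by
  rw [Real.norm_eq_abs, abs_mul, abs_mul, abs_pow, abs_two]
  exact mul_le_of_le_one_right (by positivity) (pow_le_one₀ (abs_nonneg _) (one_sub_sq_abs h))

lemma summable_hc2 : Summable (fun k => 2 * |hc (k+1)|) :=
  ((summable_nat_add_iff (f := fun k => |hc k|) 1).2 summable_hc).mul_left 2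

lemma fS_cont : ContinuousOn fS (Set.Icc 0 1) :=
  continuousOn_tsum (fun k => by fun_prop) summable_hc2 (fun k s hs => fS_bound hs k)

lemma S_int : ∑' k : ℕ, (4 : ℝ) ^ (k + 1) * genHarmonic (k + 1) 1 /
      ((k + 1 : ℝ) ^ 4 * (Nat.choose (2 * (k + 1)) (k + 1) : ℝ)) = ∫ s in (0:ℝ)..1, fS s := by
  have h := intervalIntegral.hasSum_integral_of_dominated_convergence (μ := MeasureTheory.volume) (a := 0) (b := 1)
    (F := fun k (s : ℝ) => 2 * hc (k+1) * (1 - s ^ 2) ^ k) (f := fS) (fun k _ => 2 * |hc (k+1)|)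
    (fun k => (Continuous.aestronglyMeasurable (by fun_prop)))
    (fun k => Filter.Eventually.of_forall fun s hs => fS_bound (by
      rw [Set.uIoc_of_le zero_le_one] at hs; exact ⟨hs.1.le, hs.2⟩) k)
    (Filter.Eventually.of_forall fun s _ => summable_hc2)
    (by simp)
    (Filter.Eventually.of_forall fun s hs => by
      rw [Set.uIoc_of_le zero_le_one] at hs
      exact (Summable.of_norm_bounded summable_hc2 (fun k => fS_bound ⟨hs.1.le, hs.2⟩ k)).hasSum)
  rw [← h.tsum_eq]
  congr 1; ext k
  rw [intervalIntegral.integral_const_mul, wk_int, hc_succ]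
  have hp : (Nat.choose (2 * (k+1)) (k+1) : ℝ) ≠ 0 := by
    have := Nat.choose_pos (n := 2 * (k+1)) (k := k+1) (by omega)
    positivity
  have : (k:ℝ) + 1 ≠ 0 := by positivity
  field_simp

noncomputable def LS : List (ℝ × List Lt) := sub mPHI [Lt.a, Lt.a, Lt.a, Lt.c] ++ sub mPHI [Lt.a, Lt.a, Lt.c, Lt.c]

lemma LS_len : ∀ p ∈ LS, p.2 ≠ [] := by
  intro p hp h0
  simp only [LS, List.mem_append] at hp
  rcases hp with hp | hp
  · have := length_sub _ _ p hp; rw [h0] at this; simp at this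
  · have := length_sub _ _ p hp; rw [h0] at this; simp at this

lemma fS_eq {s : ℝ} (h0 : 0 < s) (h1 : s < 1) :
    fS s = 2 * LI LS ((1 - s) / (1 + s)) / (1 - s ^ 2) := by
  have hx0 : 0 < 1 - s ^ 2 := by nlinarith
  have hx1 : 1 - s ^ 2 < 1 := by nlinarith
  have hu0 : 0 < (1 - s) / (1 + s) := div_pos (by linarith) (by linarith)
  have hu1 : (1 - s) / (1 + s) < 1 := by rw [div_lt_one (by linarith)]; linarith
  have hphi : 4 * ((1 - s) / (1 + s)) / (1 + (1 - s) / (1 + s)) ^ 2 = 1 - s ^ 2 := by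
    have : 1 + s ≠ 0 := by positivity
    have e : 1 + (1 - s) / (1 + s) = 2 / (1 + s) := by field_simp; ring
    rw [e]; field_simp; ring
  have e1 := subst SbPHI [Lt.a, Lt.a, Lt.a, Lt.c] (by simp [good]) (by simp [noB]) _ hu0.le hu1
  have e2 := subst SbPHI [Lt.a, Lt.a, Lt.c, Lt.c] (by simp [good]) (by simp [noB]) _ hu0.le hu1
  simp only [hphi] at e1 e2
  rw [LS, LI_append, ← e1, ← e2]
  have habs : |1 - s ^ 2| < 1 := by rwa [abs_of_pos hx0]
  have s1 := summable_I [Lt.a, Lt.a, Lt.a, Lt.c] habs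
  have s2 := summable_I [Lt.a, Lt.a, Lt.c, Lt.c] habs
  rw [I, I, ← s1.tsum_add s2, (s1.add s2).tsum_eq_zero_add, co_zero, co_zero, zero_mul, add_zero, zero_add,
    fS, ← tsum_mul_left, ← tsum_div_const]
  congr 1; ext k
  rw [hc, pow_succ]
  field_simp
  ring

theorem S_word : ∑' k : ℕ, (4 : ℝ) ^ (k + 1) * genHarmonic (k + 1) 1 /
      ((k + 1 : ℝ) ^ 4 * (Nat.choose (2 * (k + 1)) (k + 1) : ℝ)) = LZ (pre 1 Lt.a LS) := by
  rw [S_int]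
  have hG : Tendsto (LI (pre 1 Lt.a LS)) (𝓝[<] (1:ℝ)) (𝓝 (LZ (pre 1 Lt.a LS))) := by
    apply tendsto_LI
    intro p hp
    obtain ⟨q, _, rfl⟩ := List.mem_map.1 hp
    exact Cv_a q.2
  have hmap : ContinuousAt (fun s : ℝ => (1 - s) / (1 + s)) 0 := by
    have : (1:ℝ) + 0 ≠ 0 := by norm_num
    fun_prop (disch := assumption)
  have hmap1 : ContinuousAt (fun s : ℝ => (1 - s) / (1 + s)) 1 := by
    have : (1:ℝ) + 1 ≠ 0 := by norm_num
    fun_prop (disch := assumption)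
  have hL0 : LI (pre 1 Lt.a LS) 0 = 0 := LI_zero _ (fun p hp => by
    obtain ⟨q, _, rfl⟩ := List.mem_map.1 hp
    simp)
  have key := intervalIntegral.integral_eq_sub_of_hasDerivAt_of_tendsto (a := 0) (b := 1)
    (f := fun s => - LI (pre 1 Lt.a LS) ((1 - s) / (1 + s))) (f' := fS) (fa := - LZ (pre 1 Lt.a LS)) (fb := 0)
    (by norm_num) (fun s hs => ?_) (by
      apply ContinuousOn.intervalIntegrable
      rw [Set.uIcc_of_le zero_le_one]; exact fS_cont) ?_ ?_
  · rw [key]; ring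
  · have hu0 : 0 < (1 - s) / (1 + s) := div_pos (by linarith [hs.2]) (by linarith [hs.1])
    have hu1 : (1 - s) / (1 + s) < 1 := by rw [div_lt_one (by linarith [hs.1])]; linarith [hs.1]
    have hne : 1 + s ≠ 0 := by linarith [hs.1]
    have hne2 : 1 - s ≠ 0 := by linarith [hs.2]
    have h1 := hasDerivAt_pre 1 Lt.a LS (fun p hp _ => LS_len p hp) hu0 hu1
    have h2 : HasDerivAt (fun s : ℝ => (1 - s) / (1 + s)) (-2 / (1 + s) ^ 2) s := by
      have := ((hasDerivAt_id s).const_sub 1).div ((hasDerivAt_id s).const_add 1) hne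
      refine this.congr_deriv ?_
      simp; field_simp; ring
    have h3 := (h1.comp s h2).neg
    refine h3.congr_deriv ?_
    rw [fS_eq hs.1 hs.2]
    have e : 1 - s ^ 2 = (1 - s) * (1 + s) := by ring
    rw [e]; simp only [om]; field_simp
  · have ht : Tendsto (fun s : ℝ => (1 - s) / (1 + s)) (𝓝[>] 0) (𝓝[<] 1) := by
      refine tendsto_nhdsWithin_iff.2 ⟨?_, ?_⟩
      · have h := hmap.tendsto.mono_left (nhdsWithin_le_nhds (s := Set.Ioi 0))
        simpa using h
      · filter_upwards [self_mem_nhdsWithin] with s hs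
        simp only [Set.mem_Ioi] at hs
        simp only [Set.mem_Iio]
        rw [div_lt_one (by linarith)]; linarith
    exact (hG.comp ht).neg
  · have h := hmap1.tendsto.mono_left (nhdsWithin_le_nhds (s := Set.Iio 1))
    have hc := (continuousAt_LI (pre 1 Lt.a LS) (t := 0) (by simp)).tendsto
    rw [hL0] at hc
    have h' : Tendsto (fun s : ℝ => (1 - s) / (1 + s)) (𝓝[<] 1) (𝓝 0) := by simpa using h
    simpa using (hc.comp h').neg

end AZ

open Real
namespace AZ
open Lt Filter Topology

lemma v_b : Z [b] = Real.log 2 := Z_b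

lemma r2_def_z :
    Z [a, c] = zetaVal 2 := by
  exact Z_ac

lemma r2_sh_b_b :
    2 * Z [b, b] = Real.log 2 ^ 2 := by
  have h := shZ [b] [b] (by simp [good]) (by simp [good]) (by simp [okw]) (by simp [okw])
  simp only [sh, SZ, List.map, List.nil_append, List.cons_append, List.append_nil,
    List.sum_cons, List.sum_nil, add_zero] at h
  rw [v_b] at h
  linear_combination -h

lemma r2_sq_ac :
    Z [a, c] - 2 * Z [a, b] = 0 := by
  have h := sqZ [a, c] (by simp [good]) (by simp [noB]) (by simp [okw])
    (by simp [sub, pres, pre, mSQ, okw])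
  simp only [sub, pres, pre, mSQ, LZ, List.map, List.nil_append, List.cons_append, List.append_nil,
    List.sum_cons, List.sum_nil, add_zero] at h
  linear_combination -h

lemma v_ab :
    Z [a, b] = (1 / 2) * zetaVal 2 := by
  linear_combination
    -(1 / 2) * r2_sq_ac + (1 / 2) * r2_def_z

lemma v_ac :
    Z [a, c] = zetaVal 2 := by
  linear_combination
    r2_def_z

lemma v_bb :
    Z [b, b] = (1 / 2) * Real.log 2 ^ 2 := by
  linear_combination
    (1 / 2) * r2_sh_b_b

lemma r3_def_z :
    Z [a, a, c] = zetaVal 3 := by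
  exact Z_aac

lemma r3_st_b_ab :
    -Z [b, a, c] - Z [a, b, c] + Z [a, a, c] = (1 / 2) * Real.log 2 * zetaVal 2 := by
  have h := stZ (0, false) (1, false) [] Q_b_tendsto (by simp)
  simp only [ins, adx, SY, Y, sgn, sg, wordOf, lett, List.replicate, List.map, List.nil_append, List.cons_append, List.append_nil,
    List.sum_cons, List.sum_nil, add_zero,
    Bool.true_beq, Bool.false_beq, Bool.not_false, Bool.not_true, Nat.reduceAdd] at h
  rw [v_b, v_ab] at h
  linear_combination -h

lemma r3_sh_b_ac :
    Z [b, a, c] + Z [a, b, c] + Z [a, c, b] = Real.log 2 * zetaVal 2 := by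
  have h := shZ [b] [a, c] (by simp [good]) (by simp [good]) (by simp [okw]) (by simp [okw])
  simp only [sh, SZ, List.map, List.nil_append, List.cons_append, List.append_nil,
    List.sum_cons, List.sum_nil, add_zero] at h
  rw [v_b, v_ac] at h
  linear_combination -h

lemma r3_sh_b_bb :
    3 * Z [b, b, b] = (1 / 2) * Real.log 2 ^ 3 := by
  have h := shZ [b] [b, b] (by simp [good]) (by simp [good]) (by simp [okw]) (by simp [okw])
  simp only [sh, SZ, List.map, List.nil_append, List.cons_append, List.append_nil,
    List.sum_cons, List.sum_nil, add_zero] at h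
  rw [v_b, v_bb] at h
  linear_combination -h

lemma r3_reg_ab :
    Z [a, c, b] + Z [a, b, c] + Z [a, b, b] - Z [a, a, b] = 0 := by
  have h := regZ 0 false [] [b] rfl (by simp [good])
  simp only [insR, ins, adx, SY, Y, sgn, sg, wordOf, lett, List.replicate, sh, SZ, List.map, List.nil_append, List.cons_append, List.append_nil,
    List.sum_cons, List.sum_nil, add_zero,
    Bool.true_beq, Bool.false_beq, Bool.not_false, Bool.not_true, Nat.reduceAdd] at h
  linear_combination h

lemma r3_reg_ac :
    Z [a, c, c] - Z [a, a, c] = 0 := by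
  have h := regZ 0 true [] [c] rfl (by simp [good])
  simp only [insR, ins, adx, SY, Y, sgn, sg, wordOf, lett, List.replicate, sh, SZ, List.map, List.nil_append, List.cons_append, List.append_nil,
    List.sum_cons, List.sum_nil, add_zero,
    Bool.true_beq, Bool.false_beq, Bool.not_false, Bool.not_true, Nat.reduceAdd] at h
  linear_combination h

lemma r3_sq_aac :
    3 * Z [a, a, c] - 4 * Z [a, a, b] = 0 := by
  have h := sqZ [a, a, c] (by simp [good]) (by simp [noB]) (by simp [okw])
    (by simp [sub, pres, pre, mSQ, okw])
  simp only [sub, pres, pre, mSQ, LZ, List.map, List.nil_append, List.cons_append, List.append_nil,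
    List.sum_cons, List.sum_nil, add_zero] at h
  linear_combination -h

lemma r3_sq_acc :
    Z [a, c, c] - 2 * Z [a, c, b] - 2 * Z [a, b, c] + 2 * Z [a, b, b] = 0 := by
  have h := sqZ [a, c, c] (by simp [good]) (by simp [noB]) (by simp [okw])
    (by simp [sub, pres, pre, mSQ, okw])
  simp only [sub, pres, pre, mSQ, LZ, List.map, List.nil_append, List.cons_append, List.append_nil,
    List.sum_cons, List.sum_nil, add_zero] at h
  linear_combination -h

lemma v_aab :
    Z [a, a, b] = (3 / 4) * zetaVal 3 := by
  linear_combination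
    -(1 / 4) * r3_sq_aac + (3 / 4) * r3_def_z

lemma v_aac :
    Z [a, a, c] = zetaVal 3 := by
  linear_combination
    r3_def_z

lemma v_abb :
    Z [a, b, b] = (1 / 8) * zetaVal 3 := by
  linear_combination
    -(1 / 8) * r3_sq_aac + (1 / 2) * r3_reg_ab + (1 / 8) * r3_def_z + (1 / 4) * r3_sq_acc - (1 /
    4) * r3_reg_ac

lemma v_abc :
    Z [a, b, c] = -(3 / 2) * Real.log 2 * zetaVal 2 + (13 / 8) * zetaVal 3 := by
  linear_combination
    -r3_st_b_ab + (13 / 8) * r3_def_z - (1 / 4) * r3_sq_acc - (1 / 8) * r3_sq_aac + (1 / 2) *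
    r3_reg_ab - r3_sh_b_ac + (1 / 4) * r3_reg_ac

lemma v_acb :
    Z [a, c, b] = (3 / 2) * Real.log 2 * zetaVal 2 - zetaVal 3 := by
  linear_combination
    r3_sh_b_ac + r3_st_b_ab - r3_def_z

lemma v_acc :
    Z [a, c, c] = zetaVal 3 := by
  linear_combination
    r3_reg_ac + r3_def_z

lemma v_bac :
    Z [b, a, c] = Real.log 2 * zetaVal 2 - (5 / 8) * zetaVal 3 := by
  linear_combination
    (1 / 4) * r3_sq_acc + (1 / 8) * r3_sq_aac - (1 / 2) * r3_reg_ab - (5 / 8) * r3_def_z +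
    r3_sh_b_ac - (1 / 4) * r3_reg_ac

lemma v_bbb :
    Z [b, b, b] = (1 / 6) * Real.log 2 ^ 3 := by
  linear_combination
    (1 / 3) * r3_sh_b_bb

lemma r4_def_z4 :
    Z [a, a, a, c] = (2 / 5) * zetaVal 2 ^ 2 := by
  have h := Z_zeta 2
  have h2 := zetaVal_four
  simp only [List.replicate, List.cons_append, List.nil_append, Nat.reduceAdd] at h
  linear_combination h + h2

lemma r4_half4 :
    Z [a, a, a, b] - Z [a, a, b, b] - Z [a, b, a, b] + Z [a, b, b, b] - Z [b, a, a, b] + Z [b, a,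
    b, b] + Z [b, b, a, b] - Z [b, b, b, b] = I [a, a, a, c] (1 / 2) := by
  have h := halfZ [a, a, a, c] (by simp [good]) (by simp [noB])
    (by simp [sub, pres, pre, mHALF, okw])
  simp only [sub, pres, pre, mHALF, LZ, List.map, List.nil_append, List.cons_append, List.append_nil,
    List.sum_cons, List.sum_nil, add_zero] at h
  linear_combination -h

lemma r4_sh_b_aab :
    Z [b, a, a, b] + Z [a, b, a, b] + 2 * Z [a, a, b, b] = (3 / 4) * Real.log 2 * zetaVal 3 := by
  have h := shZ [b] [a, a, b] (by simp [good]) (by simp [good]) (by simp [okw]) (by simp [okw])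
  simp only [sh, SZ, List.map, List.nil_append, List.cons_append, List.append_nil,
    List.sum_cons, List.sum_nil, add_zero] at h
  rw [v_b, v_aab] at h
  linear_combination -h

lemma r4_sh_b_aac :
    Z [b, a, a, c] + Z [a, b, a, c] + Z [a, a, b, c] + Z [a, a, c, b] = Real.log 2 * zetaVal 3 :=
    by
  have h := shZ [b] [a, a, c] (by simp [good]) (by simp [good]) (by simp [okw]) (by simp [okw])
  simp only [sh, SZ, List.map, List.nil_append, List.cons_append, List.append_nil,
    List.sum_cons, List.sum_nil, add_zero] at h
  rw [v_b, v_aac] at h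
  linear_combination -h

lemma r4_st_b_aac :
    -Z [b, a, a, b] + Z [a, a, c, b] + Z [a, a, a, b] = Real.log 2 * zetaVal 3 := by
  have h := stZ (0, false) (2, true) [] Q_b_tendsto (by simp)
  simp only [ins, adx, SY, Y, sgn, sg, wordOf, lett, List.replicate, List.map, List.nil_append, List.cons_append, List.append_nil,
    List.sum_cons, List.sum_nil, add_zero,
    Bool.true_beq, Bool.false_beq, Bool.not_false, Bool.not_true, Nat.reduceAdd] at h
  rw [v_b, v_aac] at h
  linear_combination h

lemma r4_sh_b_abb :
    Z [b, a, b, b] + 3 * Z [a, b, b, b] = (1 / 8) * Real.log 2 * zetaVal 3 := by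
  have h := shZ [b] [a, b, b] (by simp [good]) (by simp [good]) (by simp [okw]) (by simp [okw])
  simp only [sh, SZ, List.map, List.nil_append, List.cons_append, List.append_nil,
    List.sum_cons, List.sum_nil, add_zero] at h
  rw [v_b, v_abb] at h
  linear_combination -h

lemma r4_st_b_abb :
    Z [b, a, c, c] + Z [a, b, c, c] - Z [a, b, b, c] + Z [a, b, a, c] - Z [a, a, c, c] = (1 / 8) *
    Real.log 2 * zetaVal 3 := by
  have h := stZ (0, false) (1, false) [(0, true)] Q_b_tendsto (by simp)
  simp only [ins, adx, SY, Y, sgn, sg, wordOf, lett, List.replicate, List.map, List.nil_append, List.cons_append, List.append_nil,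
    List.sum_cons, List.sum_nil, add_zero,
    Bool.true_beq, Bool.false_beq, Bool.not_false, Bool.not_true, Nat.reduceAdd] at h
  rw [v_b, v_abb] at h
  linear_combination h

lemma r4_st_b_abc :
    Z [b, a, c, b] + 2 * Z [a, b, c, b] + Z [a, b, a, b] - Z [a, a, c, b] = -(3 / 2) * Real.log 2
    ^ 2 * zetaVal 2 + (13 / 8) * Real.log 2 * zetaVal 3 := by
  have h := stZ (0, false) (1, false) [(0, false)] Q_b_tendsto (by simp)
  simp only [ins, adx, SY, Y, sgn, sg, wordOf, lett, List.replicate, List.map, List.nil_append, List.cons_append, List.append_nil,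
    List.sum_cons, List.sum_nil, add_zero,
    Bool.true_beq, Bool.false_beq, Bool.not_false, Bool.not_true, Nat.reduceAdd] at h
  rw [v_b, v_abc] at h
  linear_combination -h

lemma r4_sh_b_acb :
    Z [b, a, c, b] + Z [a, b, c, b] + 2 * Z [a, c, b, b] = (3 / 2) * Real.log 2 ^ 2 * zetaVal 2 -
    Real.log 2 * zetaVal 3 := by
  have h := shZ [b] [a, c, b] (by simp [good]) (by simp [good]) (by simp [okw]) (by simp [okw])
  simp only [sh, SZ, List.map, List.nil_append, List.cons_append, List.append_nil,
    List.sum_cons, List.sum_nil, add_zero] at h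
  rw [v_b, v_acb] at h
  linear_combination -h

lemma r4_sh_b_acc :
    Z [b, a, c, c] + Z [a, b, c, c] + Z [a, c, b, c] + Z [a, c, c, b] = Real.log 2 * zetaVal 3 :=
    by
  have h := shZ [b] [a, c, c] (by simp [good]) (by simp [good]) (by simp [okw]) (by simp [okw])
  simp only [sh, SZ, List.map, List.nil_append, List.cons_append, List.append_nil,
    List.sum_cons, List.sum_nil, add_zero] at h
  rw [v_b, v_acc] at h
  linear_combination -h

lemma r4_st_b_acc :
    Z [b, a, b, b] - Z [a, c, b, b] + Z [a, c, c, b] + Z [a, c, a, b] - Z [a, a, b, b] = Real.log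
    2 * zetaVal 3 := by
  have h := stZ (0, false) (1, true) [(0, true)] Q_b_tendsto (by simp)
  simp only [ins, adx, SY, Y, sgn, sg, wordOf, lett, List.replicate, List.map, List.nil_append, List.cons_append, List.append_nil,
    List.sum_cons, List.sum_nil, add_zero,
    Bool.true_beq, Bool.false_beq, Bool.not_false, Bool.not_true, Nat.reduceAdd] at h
  rw [v_b, v_acc] at h
  linear_combination h

lemma r4_sh_b_bbb :
    4 * Z [b, b, b, b] = (1 / 6) * Real.log 2 ^ 4 := by
  have h := shZ [b] [b, b, b] (by simp [good]) (by simp [good]) (by simp [okw]) (by simp [okw])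
  simp only [sh, SZ, List.map, List.nil_append, List.cons_append, List.append_nil,
    List.sum_cons, List.sum_nil, add_zero] at h
  rw [v_b, v_bbb] at h
  linear_combination -h

lemma r4_st_ab_ab :
    -2 * Z [a, b, a, c] + Z [a, a, a, c] = (1 / 4) * zetaVal 2 ^ 2 := by
  have h := stZ (1, false) (1, false) [] (Q_tendsto 0 false []) (by simp)
  simp only [ins, adx, SY, Y, sgn, sg, wordOf, lett, List.replicate, List.map, List.nil_append, List.cons_append, List.append_nil,
    List.sum_cons, List.sum_nil, add_zero,
    Bool.true_beq, Bool.false_beq, Bool.not_false, Bool.not_true, Nat.reduceAdd] at h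
  rw [v_ab] at h
  linear_combination -h

lemma r4_sh_ab_ac :
    Z [a, b, a, c] + 2 * Z [a, a, b, c] + 2 * Z [a, a, c, b] + Z [a, c, a, b] = (1 / 2) * zetaVal
    2 ^ 2 := by
  have h := shZ [a, b] [a, c] (by simp [good]) (by simp [good]) (by simp [okw]) (by simp [okw])
  simp only [sh, SZ, List.map, List.nil_append, List.cons_append, List.append_nil,
    List.sum_cons, List.sum_nil, add_zero] at h
  rw [v_ab, v_ac] at h
  linear_combination -h

lemma r4_st_ab_ac :
    -Z [a, b, a, b] + Z [a, c, a, b] + Z [a, a, a, b] = (1 / 2) * zetaVal 2 ^ 2 := by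
  have h := stZ (1, false) (1, true) [] (Q_tendsto 0 false []) (by simp)
  simp only [ins, adx, SY, Y, sgn, sg, wordOf, lett, List.replicate, List.map, List.nil_append, List.cons_append, List.append_nil,
    List.sum_cons, List.sum_nil, add_zero,
    Bool.true_beq, Bool.false_beq, Bool.not_false, Bool.not_true, Nat.reduceAdd] at h
  rw [v_ab, v_ac] at h
  linear_combination h

lemma r4_sh_ab_bb :
    3 * Z [a, b, b, b] + 2 * Z [b, a, b, b] + Z [b, b, a, b] = (1 / 4) * Real.log 2 ^ 2 * zetaVal
    2 := by
  have h := shZ [a, b] [b, b] (by simp [good]) (by simp [good]) (by simp [okw]) (by simp [okw])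
  simp only [sh, SZ, List.map, List.nil_append, List.cons_append, List.append_nil,
    List.sum_cons, List.sum_nil, add_zero] at h
  rw [v_ab, v_bb] at h
  linear_combination -h

lemma r4_reg_aab :
    Z [a, c, a, b] + Z [a, a, c, b] + Z [a, a, b, c] + Z [a, a, b, b] - Z [a, a, a, b] = 0 := by
  have h := regZ 1 false [] [a, b] rfl (by simp [good])
  simp only [insR, ins, adx, SY, Y, sgn, sg, wordOf, lett, List.replicate, sh, SZ, List.map, List.nil_append, List.cons_append, List.append_nil,
    List.sum_cons, List.sum_nil, add_zero,
    Bool.true_beq, Bool.false_beq, Bool.not_false, Bool.not_true, Nat.reduceAdd] at h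
  linear_combination h

lemma r4_reg_aac :
    Z [a, c, a, c] + Z [a, a, c, c] - Z [a, a, a, c] = 0 := by
  have h := regZ 1 true [] [a, c] rfl (by simp [good])
  simp only [insR, ins, adx, SY, Y, sgn, sg, wordOf, lett, List.replicate, sh, SZ, List.map, List.nil_append, List.cons_append, List.append_nil,
    List.sum_cons, List.sum_nil, add_zero,
    Bool.true_beq, Bool.false_beq, Bool.not_false, Bool.not_true, Nat.reduceAdd] at h
  linear_combination h

lemma r4_reg_abb :
    Z [a, c, b, b] + Z [a, b, c, b] + Z [a, b, b, c] + 2 * Z [a, b, b, b] - Z [a, b, a, b] - Z [a,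
    a, b, b] = 0 := by
  have h := regZ 0 false [(0, true)] [b, b] rfl (by simp [good])
  simp only [insR, ins, adx, SY, Y, sgn, sg, wordOf, lett, List.replicate, sh, SZ, List.map, List.nil_append, List.cons_append, List.append_nil,
    List.sum_cons, List.sum_nil, add_zero,
    Bool.true_beq, Bool.false_beq, Bool.not_false, Bool.not_true, Nat.reduceAdd] at h
  linear_combination h

lemma r4_reg_abc :
    Z [a, c, b, c] + Z [a, b, c, c] + Z [a, b, b, c] - Z [a, b, a, c] - Z [a, a, b, c] = 0 := by
  have h := regZ 0 false [(0, false)] [b, c] rfl (by simp [good])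
  simp only [insR, ins, adx, SY, Y, sgn, sg, wordOf, lett, List.replicate, sh, SZ, List.map, List.nil_append, List.cons_append, List.append_nil,
    List.sum_cons, List.sum_nil, add_zero,
    Bool.true_beq, Bool.false_beq, Bool.not_false, Bool.not_true, Nat.reduceAdd] at h
  linear_combination h

lemma r4_reg_acb :
    Z [a, c, c, b] + Z [a, c, b, c] + Z [a, c, b, b] - Z [a, c, a, b] - Z [a, a, c, b] = 0 := by
  have h := regZ 0 true [(0, false)] [c, b] rfl (by simp [good])
  simp only [insR, ins, adx, SY, Y, sgn, sg, wordOf, lett, List.replicate, sh, SZ, List.map, List.nil_append, List.cons_append, List.append_nil,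
    List.sum_cons, List.sum_nil, add_zero,
    Bool.true_beq, Bool.false_beq, Bool.not_false, Bool.not_true, Nat.reduceAdd] at h
  linear_combination h

lemma r4_reg_acc :
    Z [a, c, c, c] - Z [a, c, a, c] - Z [a, a, c, c] = 0 := by
  have h := regZ 0 true [(0, true)] [c, c] rfl (by simp [good])
  simp only [insR, ins, adx, SY, Y, sgn, sg, wordOf, lett, List.replicate, sh, SZ, List.map, List.nil_append, List.cons_append, List.append_nil,
    List.sum_cons, List.sum_nil, add_zero,
    Bool.true_beq, Bool.false_beq, Bool.not_false, Bool.not_true, Nat.reduceAdd] at h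
  linear_combination h

lemma r4_sq_aacc :
    3 * Z [a, a, c, c] - 4 * Z [a, a, c, b] - 4 * Z [a, a, b, c] + 4 * Z [a, a, b, b] = 0 := by
  have h := sqZ [a, a, c, c] (by simp [good]) (by simp [noB]) (by simp [okw])
    (by simp [sub, pres, pre, mSQ, okw])
  simp only [sub, pres, pre, mSQ, LZ, List.map, List.nil_append, List.cons_append, List.append_nil,
    List.sum_cons, List.sum_nil, add_zero] at h
  linear_combination -h

lemma r4_sq_acac :
    3 * Z [a, c, a, c] - 4 * Z [a, c, a, b] - 4 * Z [a, b, a, c] + 4 * Z [a, b, a, b] = 0 := by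
  have h := sqZ [a, c, a, c] (by simp [good]) (by simp [noB]) (by simp [okw])
    (by simp [sub, pres, pre, mSQ, okw])
  simp only [sub, pres, pre, mSQ, LZ, List.map, List.nil_append, List.cons_append, List.append_nil,
    List.sum_cons, List.sum_nil, add_zero] at h
  linear_combination -h

lemma r4_sq_accc :
    Z [a, c, c, c] - 2 * Z [a, c, c, b] - 2 * Z [a, c, b, c] + 2 * Z [a, c, b, b] - 2 * Z [a, b,
    c, c] + 2 * Z [a, b, c, b] + 2 * Z [a, b, b, c] - 2 * Z [a, b, b, b] = 0 := by
  have h := sqZ [a, c, c, c] (by simp [good]) (by simp [noB]) (by simp [okw])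
    (by simp [sub, pres, pre, mSQ, okw])
  simp only [sub, pres, pre, mSQ, LZ, List.map, List.nil_append, List.cons_append, List.append_nil,
    List.sum_cons, List.sum_nil, add_zero] at h
  linear_combination -h

lemma v_aaab :
    Z [a, a, a, b] = (7 / 20) * zetaVal 2 ^ 2 := by
  linear_combination
    (1 / 2) * r4_sh_ab_ac - (1 / 2) * r4_reg_aab - (3 / 8) * r4_def_z4 + (1 / 8) * r4_sq_aacc + (1
    / 8) * r4_sq_acac - (3 / 8) * r4_reg_aac + (1 / 2) * r4_st_ab_ac

lemma v_aaac :
    Z [a, a, a, c] = (2 / 5) * zetaVal 2 ^ 2 := by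
  linear_combination
    r4_def_z4

lemma v_aabb :
    Z [a, a, b, b] = (1 / 12) * Real.log 2 ^ 4 - (1 / 2) * Real.log 2 ^ 2 * zetaVal 2 + (7 / 4) *
    Real.log 2 * zetaVal 3 - (3 / 4) * zetaVal 2 ^ 2 + 2 * I [a, a, a, c] (1 / 2) := by
  linear_combination
    2 * r4_half4 + (5 / 3) * r4_sh_b_abb - (7 / 9) * r4_sh_ab_ac + (4 / 9) * r4_reg_aab + 2 *
    r4_sh_b_aab + (25 / 36) * r4_def_z4 - 2 * r4_sh_ab_bb - (13 / 36) * r4_sq_aacc - (17 / 36) *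
    r4_sq_acac + (5 / 4) * r4_reg_aac - (14 / 9) * r4_st_ab_ac + (1 / 6) * r4_sq_accc - (1 / 3) *
    r4_reg_abb - (1 / 3) * r4_sh_b_acc + (5 / 9) * r4_st_ab_ab - (1 / 6) * r4_reg_acc + (1 / 3) *
    r4_reg_abc + (1 / 3) * r4_st_b_acc + (1 / 3) * r4_st_b_abb + (1 / 3) * r4_reg_acb + (1 / 2) *
    r4_sh_b_bbb

lemma v_aabc :
    Z [a, a, b, c] = (1 / 12) * Real.log 2 ^ 4 - (1 / 2) * Real.log 2 ^ 2 * zetaVal 2 - (1 / 5) *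
    zetaVal 2 ^ 2 + 2 * I [a, a, a, c] (1 / 2) := by
  linear_combination
    -r4_st_b_aac + 2 * r4_half4 + (5 / 3) * r4_sh_b_abb + (13 / 18) * r4_sh_ab_ac - (31 / 72) *
    r4_def_z4 - 2 * r4_sh_ab_bb + (1 / 72) * r4_sq_aacc - (7 / 72) * r4_sq_acac + (1 / 8) *
    r4_reg_aac + (1 / 6) * r4_sq_accc - (1 / 3) * r4_reg_abb + r4_sh_b_aab - (1 / 3) * r4_sh_b_acc
    + (5 / 9) * r4_st_ab_ab - (19 / 18) * r4_st_ab_ac - (1 / 6) * r4_reg_acc + (1 / 3) *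
    r4_reg_abc + (1 / 3) * r4_st_b_acc - (1 / 18) * r4_reg_aab + (1 / 3) * r4_st_b_abb + (1 / 3) *
    r4_reg_acb + (1 / 2) * r4_sh_b_bbb

lemma v_aacb :
    Z [a, a, c, b] = (7 / 4) * Real.log 2 * zetaVal 3 - (19 / 40) * zetaVal 2 ^ 2 := by
  linear_combination
    r4_st_b_aac + r4_sh_b_aab - r4_sh_ab_ac + (1 / 2) * r4_st_ab_ab + r4_def_z4 - r4_st_ab_ac - (1
    / 2) * r4_sq_aacc - (1 / 2) * r4_sq_acac + (3 / 2) * r4_reg_aac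

lemma v_aacc :
    Z [a, a, c, c] = (1 / 10) * zetaVal 2 ^ 2 := by
  linear_combination
    (2 / 3) * r4_sh_ab_ac + (2 / 3) * r4_st_ab_ab - (1 / 6) * r4_def_z4 - (2 / 3) * r4_reg_aab +
    (1 / 6) * r4_sq_aacc - (1 / 6) * r4_sq_acac + (1 / 2) * r4_reg_aac - (2 / 3) * r4_st_ab_ac

lemma v_abab :
    Z [a, b, a, b] = -(1 / 6) * Real.log 2 ^ 4 + Real.log 2 ^ 2 * zetaVal 2 - (7 / 2) * Real.log 2
    * zetaVal 3 + (13 / 8) * zetaVal 2 ^ 2 - 4 * I [a, a, a, c] (1 / 2) := by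
  linear_combination
    -4 * r4_half4 - 4 * r4_sh_b_aab - (10 / 3) * r4_sh_b_abb + (37 / 18) * r4_sh_ab_ac - (29 / 18)
    * r4_st_ab_ab - (145 / 72) * r4_def_z4 + (65 / 18) * r4_st_ab_ac - (7 / 18) * r4_reg_aab + 4 *
    r4_sh_ab_bb + (79 / 72) * r4_sq_aacc + (95 / 72) * r4_sq_acac - (29 / 8) * r4_reg_aac - (1 /
    3) * r4_sq_accc + (2 / 3) * r4_reg_abb + (2 / 3) * r4_sh_b_acc + (1 / 3) * r4_reg_acc - (2 /
    3) * r4_reg_abc - (2 / 3) * r4_st_b_acc - (2 / 3) * r4_st_b_abb - (2 / 3) * r4_reg_acb -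
    r4_sh_b_bbb

lemma v_abbb :
    Z [a, b, b, b] = -(1 / 24) * Real.log 2 ^ 4 + (1 / 4) * Real.log 2 ^ 2 * zetaVal 2 - (7 / 8) *
    Real.log 2 * zetaVal 3 + (2 / 5) * zetaVal 2 ^ 2 - I [a, a, a, c] (1 / 2) := by
  linear_combination
    -(2 / 3) * r4_sh_b_abb + r4_sh_ab_bb - (1 / 6) * r4_sq_accc + (1 / 3) * r4_reg_abb -
    r4_sh_b_aab - r4_half4 + (1 / 3) * r4_sh_b_acc + (5 / 18) * r4_sh_ab_ac - (5 / 9) *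
    r4_st_ab_ab - (23 / 72) * r4_def_z4 + (19 / 18) * r4_st_ab_ac + (1 / 6) * r4_reg_acc - (7 / 8)
    * r4_reg_aac - (1 / 3) * r4_reg_abc - (1 / 3) * r4_st_b_acc + (1 / 18) * r4_reg_aab + (17 /
    72) * r4_sq_aacc - (1 / 3) * r4_st_b_abb - (1 / 3) * r4_reg_acb + (25 / 72) * r4_sq_acac - (1
    / 4) * r4_sh_b_bbb

lemma v_abbc :
    Z [a, b, b, c] = (1 / 12) * Real.log 2 ^ 4 + (1 / 4) * Real.log 2 ^ 2 * zetaVal 2 - (9 / 20) *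
    zetaVal 2 ^ 2 + 2 * I [a, a, a, c] (1 / 2) := by
  linear_combination
    -(1 / 6) * r4_reg_abb + r4_sh_b_aab - (1 / 4) * r4_st_b_abc - r4_st_b_aac + 2 * r4_half4 + (19
    / 12) * r4_sh_b_abb + (1 / 4) * r4_sh_b_acb + (1 / 36) * r4_sh_ab_ac - (5 / 9) * r4_st_ab_ab +
    (1 / 18) * r4_def_z4 - (25 / 36) * r4_st_ab_ac + (11 / 36) * r4_reg_aab + (1 / 3) *
    r4_sh_b_acc - 2 * r4_sh_ab_bb - (1 / 72) * r4_sq_aacc - (1 / 3) * r4_st_b_abb - (1 / 3) *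
    r4_reg_acb + (7 / 72) * r4_sq_acac - (1 / 2) * r4_reg_aac + (5 / 24) * r4_sq_accc - (5 / 24) *
    r4_reg_acc + (5 / 12) * r4_reg_abc + (5 / 12) * r4_st_b_acc + (1 / 2) * r4_sh_b_bbb

lemma v_abcb :
    Z [a, b, c, b] = -(3 / 2) * Real.log 2 ^ 2 * zetaVal 2 + (21 / 8) * Real.log 2 * zetaVal 3 -
    (7 / 20) * zetaVal 2 ^ 2 := by
  linear_combination
    -(5 / 9) * r4_sh_ab_ac + (10 / 9) * r4_st_ab_ab + (37 / 72) * r4_def_z4 + r4_sh_b_aab + (1 /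
    2) * r4_st_b_abc + r4_st_b_aac - (1 / 6) * r4_sh_b_abb - (10 / 9) * r4_st_ab_ac - (1 / 9) *
    r4_reg_aab - (1 / 2) * r4_sh_b_acb - (2 / 3) * r4_sh_b_acc + (1 / 3) * r4_reg_abb - (25 / 72)
    * r4_sq_aacc + (2 / 3) * r4_st_b_abb + (2 / 3) * r4_reg_acb - (41 / 72) * r4_sq_acac + (13 /
    8) * r4_reg_aac + (1 / 12) * r4_sq_accc - (1 / 12) * r4_reg_acc + (1 / 6) * r4_reg_abc + (1 /
    6) * r4_st_b_acc

lemma v_abcc :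
    Z [a, b, c, c] = (1 / 8) * Real.log 2 ^ 4 - (11 / 20) * zetaVal 2 ^ 2 + 3 * I [a, a, a, c] (1
    / 2) := by
  linear_combination
    -(4 / 3) * r4_sh_b_acc + (1 / 3) * r4_reg_acb - r4_st_b_aac + 3 * r4_half4 + 2 * r4_sh_b_aab -
    (1 / 4) * r4_st_b_abc + (23 / 12) * r4_sh_b_abb + (1 / 4) * r4_sh_b_acb + (41 / 36) *
    r4_sh_ab_ac + (11 / 9) * r4_st_ab_ab - (17 / 36) * r4_def_z4 - (89 / 36) * r4_st_ab_ac - (17 /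
    36) * r4_reg_aab + (13 / 12) * r4_reg_abc + (1 / 6) * r4_reg_abb + (13 / 12) * r4_st_b_acc - 3
    * r4_sh_ab_bb + (13 / 72) * r4_sq_aacc + (4 / 3) * r4_st_b_abb - (19 / 72) * r4_sq_acac + (3 /
    4) * r4_reg_aac + (1 / 24) * r4_sq_accc - (1 / 24) * r4_reg_acc + (3 / 4) * r4_sh_b_bbb

lemma v_acab :
    Z [a, c, a, b] = -(1 / 6) * Real.log 2 ^ 4 + Real.log 2 ^ 2 * zetaVal 2 - (7 / 2) * Real.log 2
    * zetaVal 3 + (71 / 40) * zetaVal 2 ^ 2 - 4 * I [a, a, a, c] (1 / 2) := by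
  linear_combination
    (14 / 9) * r4_sh_ab_ac - (29 / 18) * r4_st_ab_ab - (59 / 36) * r4_def_z4 - (10 / 3) *
    r4_sh_b_abb - 4 * r4_sh_b_aab - 4 * r4_half4 + 4 * r4_sh_ab_bb + (35 / 36) * r4_sq_aacc + (43
    / 36) * r4_sq_acac - (13 / 4) * r4_reg_aac + (37 / 9) * r4_st_ab_ac - (1 / 3) * r4_sq_accc +
    (2 / 3) * r4_reg_abb + (2 / 3) * r4_sh_b_acc + (1 / 3) * r4_reg_acc - (2 / 3) * r4_reg_abc -
    (2 / 3) * r4_st_b_acc + (1 / 9) * r4_reg_aab - (2 / 3) * r4_st_b_abb - (2 / 3) * r4_reg_acb -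
    r4_sh_b_bbb

lemma v_acbb :
    Z [a, c, b, b] = -(1 / 12) * Real.log 2 ^ 4 + (5 / 4) * Real.log 2 ^ 2 * zetaVal 2 - (21 / 8)
    * Real.log 2 * zetaVal 3 + (7 / 8) * zetaVal 2 ^ 2 - 2 * I [a, a, a, c] (1 / 2) := by
  linear_combination
    (5 / 4) * r4_sh_ab_ac - (1 / 2) * r4_st_ab_ab - (5 / 4) * r4_def_z4 - 2 * r4_sh_b_aab - (1 /
    4) * r4_st_b_abc - 2 * r4_half4 - (7 / 4) * r4_sh_b_abb + (1 / 4) * r4_sh_b_acb + (7 / 4) *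
    r4_st_ab_ac - (1 / 4) * r4_reg_aab + (1 / 2) * r4_reg_abb + 2 * r4_sh_ab_bb + (5 / 8) *
    r4_sq_aacc + (5 / 8) * r4_sq_acac - (7 / 4) * r4_reg_aac - (1 / 8) * r4_sq_accc + (1 / 8) *
    r4_reg_acc - (1 / 4) * r4_reg_abc - (1 / 4) * r4_st_b_acc - (1 / 2) * r4_sh_b_bbb

lemma v_acbc :
    Z [a, c, b, c] = -(1 / 8) * Real.log 2 ^ 4 - (3 / 4) * Real.log 2 ^ 2 * zetaVal 2 + (7 / 8) *
    zetaVal 2 ^ 2 - 3 * I [a, a, a, c] (1 / 2) := by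
  linear_combination
    (1 / 3) * r4_reg_acb + r4_st_b_aac - 3 * r4_half4 - 2 * r4_sh_b_aab + (1 / 2) * r4_st_b_abc -
    (11 / 6) * r4_sh_b_abb - (1 / 2) * r4_sh_b_acb - (7 / 6) * r4_st_b_acc - (4 / 9) * r4_sh_ab_ac
    + (19 / 9) * r4_st_ab_ac + (1 / 9) * r4_reg_aab + (2 / 3) * r4_sh_b_acc - (1 / 3) * r4_reg_abb
    - (11 / 18) * r4_st_ab_ab + (35 / 72) * r4_def_z4 + 3 * r4_sh_ab_bb - (11 / 72) * r4_sq_aacc -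
    (2 / 3) * r4_st_b_abb + (5 / 72) * r4_sq_acac - (1 / 8) * r4_reg_aac - (1 / 12) * r4_sq_accc +
    (1 / 12) * r4_reg_acc - (1 / 6) * r4_reg_abc - (3 / 4) * r4_sh_b_bbb

lemma v_accb :
    Z [a, c, c, b] = (1 / 24) * Real.log 2 ^ 4 + (1 / 2) * Real.log 2 ^ 2 * zetaVal 2 + (7 / 8) *
    Real.log 2 * zetaVal 3 - (9 / 20) * zetaVal 2 ^ 2 + I [a, a, a, c] (1 / 2) := by
  linear_combination
    -(3 / 4) * r4_st_ab_ac + r4_sh_b_aab - (1 / 4) * r4_st_b_abc + (1 / 4) * r4_sh_b_acb + (3 / 4)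
    * r4_st_b_acc - (1 / 4) * r4_sh_ab_ac + (1 / 8) * r4_def_z4 + (1 / 4) * r4_reg_aab + r4_half4
    + (1 / 4) * r4_sh_b_abb + (1 / 2) * r4_reg_abb - r4_sh_ab_bb + (1 / 8) * r4_reg_aac - (1 / 8)
    * r4_sq_accc + (1 / 8) * r4_reg_acc - (1 / 4) * r4_reg_abc + (1 / 4) * r4_sh_b_bbb

lemma v_accc :
    Z [a, c, c, c] = (2 / 5) * zetaVal 2 ^ 2 := by
  linear_combination
    r4_reg_acc + r4_def_z4 + r4_reg_aac

lemma v_baab :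
    Z [b, a, a, b] = (3 / 4) * Real.log 2 * zetaVal 3 - (1 / 8) * zetaVal 2 ^ 2 := by
  linear_combination
    -(1 / 2) * r4_reg_aab + r4_sh_b_aab + (1 / 2) * r4_st_ab_ab + (5 / 8) * r4_def_z4 - (1 / 2) *
    r4_sh_ab_ac - (1 / 2) * r4_st_ab_ac - (3 / 8) * r4_sq_aacc - (3 / 8) * r4_sq_acac + (9 / 8) *
    r4_reg_aac

lemma v_baac :
    Z [b, a, a, c] = -(1 / 12) * Real.log 2 ^ 4 + (1 / 2) * Real.log 2 ^ 2 * zetaVal 2 - (3 / 4) *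
    Real.log 2 * zetaVal 3 + (3 / 5) * zetaVal 2 ^ 2 - 2 * I [a, a, a, c] (1 / 2) := by
  linear_combination
    r4_sh_b_aac - (5 / 3) * r4_sh_b_abb - (77 / 72) * r4_def_z4 - 2 * r4_sh_b_aab - 2 * r4_half4 +
    2 * r4_sh_ab_bb + (35 / 72) * r4_sq_aacc + (43 / 72) * r4_sq_acac - (13 / 8) * r4_reg_aac +
    (37 / 18) * r4_st_ab_ac - (1 / 6) * r4_sq_accc + (1 / 3) * r4_reg_abb + (1 / 3) * r4_sh_b_acc
    + (5 / 18) * r4_sh_ab_ac - (5 / 9) * r4_st_ab_ab + (1 / 6) * r4_reg_acc - (1 / 3) * r4_reg_abc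
    - (1 / 3) * r4_st_b_acc + (1 / 18) * r4_reg_aab - (1 / 3) * r4_st_b_abb - (1 / 3) * r4_reg_acb
    - (1 / 2) * r4_sh_b_bbb

lemma v_babb :
    Z [b, a, b, b] = (1 / 8) * Real.log 2 ^ 4 - (3 / 4) * Real.log 2 ^ 2 * zetaVal 2 + (11 / 4) *
    Real.log 2 * zetaVal 3 - (6 / 5) * zetaVal 2 ^ 2 + 3 * I [a, a, a, c] (1 / 2) := by
  linear_combination
    -3 * r4_sh_ab_bb + 3 * r4_sh_b_abb + (1 / 2) * r4_sq_accc - r4_reg_abb + 3 * r4_sh_b_aab + 3 *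
    r4_half4 - r4_sh_b_acc - (5 / 6) * r4_sh_ab_ac + (5 / 3) * r4_st_ab_ab + (23 / 24) * r4_def_z4
    - (19 / 6) * r4_st_ab_ac - (1 / 2) * r4_reg_acc + (21 / 8) * r4_reg_aac + r4_reg_abc +
    r4_st_b_acc - (1 / 6) * r4_reg_aab - (17 / 24) * r4_sq_aacc + r4_st_b_abb + r4_reg_acb - (25 /
    24) * r4_sq_acac + (3 / 4) * r4_sh_b_bbb

lemma v_bbab :
    Z [b, b, a, b] = -(1 / 8) * Real.log 2 ^ 4 + Real.log 2 ^ 2 * zetaVal 2 - (23 / 8) * Real.log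
    2 * zetaVal 3 + (6 / 5) * zetaVal 2 ^ 2 - 3 * I [a, a, a, c] (1 / 2) := by
  linear_combination
    -(1 / 2) * r4_sq_accc - 4 * r4_sh_b_abb + r4_reg_abb - 3 * r4_sh_b_aab - 3 * r4_half4 +
    r4_sh_b_acc + (5 / 6) * r4_sh_ab_ac - (5 / 3) * r4_st_ab_ab - (23 / 24) * r4_def_z4 + (19 / 6)
    * r4_st_ab_ac + (1 / 2) * r4_reg_acc - (21 / 8) * r4_reg_aac - r4_reg_abc - r4_st_b_acc + (1 /
    6) * r4_reg_aab + 4 * r4_sh_ab_bb + (17 / 24) * r4_sq_aacc - r4_st_b_abb - r4_reg_acb + (25 /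
    24) * r4_sq_acac - (3 / 4) * r4_sh_b_bbb

end AZ

open Real
namespace AZ
open Lt Filter Topology

lemma r5_def_z :
    Z [a, a, a, a, c] = zetaVal 5 := by
  exact Z_aaaac

lemma r5_half5 :
    Z [a, a, a, a, b] - Z [a, a, a, b, b] - Z [a, a, b, a, b] + Z [a, a, b, b, b] - Z [a, b, a, a,
    b] + Z [a, b, a, b, b] + Z [a, b, b, a, b] - Z [a, b, b, b, b] - Z [b, a, a, a, b] + Z [b, a,
    a, b, b] + Z [b, a, b, a, b] - Z [b, a, b, b, b] + Z [b, b, a, a, b] - Z [b, b, a, b, b] - Z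
    [b, b, b, a, b] + Z [b, b, b, b, b] = I [a, a, a, a, c] (1 / 2) := by
  have h := halfZ [a, a, a, a, c] (by simp [good]) (by simp [noB])
    (by simp [sub, pres, pre, mHALF, okw])
  simp only [sub, pres, pre, mHALF, LZ, List.map, List.nil_append, List.cons_append, List.append_nil,
    List.sum_cons, List.sum_nil, add_zero] at h
  linear_combination -h

lemma r5_sh_b_aaab :
    Z [b, a, a, a, b] + Z [a, b, a, a, b] + Z [a, a, b, a, b] + 2 * Z [a, a, a, b, b] = (7 / 20) *
    Real.log 2 * zetaVal 2 ^ 2 := by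
  have h := shZ [b] [a, a, a, b] (by simp [good]) (by simp [good]) (by simp [okw]) (by simp [okw])
  simp only [sh, SZ, List.map, List.nil_append, List.cons_append, List.append_nil,
    List.sum_cons, List.sum_nil, add_zero] at h
  rw [v_b, v_aaab] at h
  linear_combination -h

lemma r5_st_b_aaac :
    -Z [b, a, a, a, b] + Z [a, a, a, c, b] + Z [a, a, a, a, b] = (2 / 5) * Real.log 2 * zetaVal 2
    ^ 2 := by
  have h := stZ (0, false) (3, true) [] Q_b_tendsto (by simp)
  simp only [ins, adx, SY, Y, sgn, sg, wordOf, lett, List.replicate, List.map, List.nil_append, List.cons_append, List.append_nil,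
    List.sum_cons, List.sum_nil, add_zero,
    Bool.true_beq, Bool.false_beq, Bool.not_false, Bool.not_true, Nat.reduceAdd] at h
  rw [v_b, v_aaac] at h
  linear_combination h

lemma r5_sh_b_aabb :
    Z [b, a, a, b, b] + Z [a, b, a, b, b] + 3 * Z [a, a, b, b, b] = (7 / 4) * Real.log 2 ^ 2 *
    zetaVal 3 + 2 * Real.log 2 * I [a, a, a, c] (1 / 2) - (3 / 4) * Real.log 2 * zetaVal 2 ^ 2 -
    (1 / 2) * Real.log 2 ^ 3 * zetaVal 2 + (1 / 12) * Real.log 2 ^ 5 := by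
  have h := shZ [b] [a, a, b, b] (by simp [good]) (by simp [good]) (by simp [okw]) (by simp [okw])
  simp only [sh, SZ, List.map, List.nil_append, List.cons_append, List.append_nil,
    List.sum_cons, List.sum_nil, add_zero] at h
  rw [v_b, v_aabb] at h
  linear_combination -h

lemma r5_st_b_aabb :
    Z [b, a, a, c, c] + Z [a, a, b, c, c] - Z [a, a, b, b, c] + Z [a, a, b, a, c] - Z [a, a, a, c,
    c] = (7 / 4) * Real.log 2 ^ 2 * zetaVal 3 + 2 * Real.log 2 * I [a, a, a, c] (1 / 2) - (3 / 4)
    * Real.log 2 * zetaVal 2 ^ 2 - (1 / 2) * Real.log 2 ^ 3 * zetaVal 2 + (1 / 12) * Real.log 2 ^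
    5 := by
  have h := stZ (0, false) (2, false) [(0, true)] Q_b_tendsto (by simp)
  simp only [ins, adx, SY, Y, sgn, sg, wordOf, lett, List.replicate, List.map, List.nil_append, List.cons_append, List.append_nil,
    List.sum_cons, List.sum_nil, add_zero,
    Bool.true_beq, Bool.false_beq, Bool.not_false, Bool.not_true, Nat.reduceAdd] at h
  rw [v_b, v_aabb] at h
  linear_combination h

lemma r5_st_b_aabc :
    Z [b, a, a, c, b] + 2 * Z [a, a, b, c, b] + Z [a, a, b, a, b] - Z [a, a, a, c, b] = -(1 / 5) *
    Real.log 2 * zetaVal 2 ^ 2 + (1 / 12) * Real.log 2 ^ 5 - (1 / 2) * Real.log 2 ^ 3 * zetaVal 2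
    + 2 * Real.log 2 * I [a, a, a, c] (1 / 2) := by
  have h := stZ (0, false) (2, false) [(0, false)] Q_b_tendsto (by simp)
  simp only [ins, adx, SY, Y, sgn, sg, wordOf, lett, List.replicate, List.map, List.nil_append, List.cons_append, List.append_nil,
    List.sum_cons, List.sum_nil, add_zero,
    Bool.true_beq, Bool.false_beq, Bool.not_false, Bool.not_true, Nat.reduceAdd] at h
  rw [v_b, v_aabc] at h
  linear_combination -h

lemma r5_sh_b_aacb :
    Z [b, a, a, c, b] + Z [a, b, a, c, b] + Z [a, a, b, c, b] + 2 * Z [a, a, c, b, b] = (7 / 4) *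
    Real.log 2 ^ 2 * zetaVal 3 - (19 / 40) * Real.log 2 * zetaVal 2 ^ 2 := by
  have h := shZ [b] [a, a, c, b] (by simp [good]) (by simp [good]) (by simp [okw]) (by simp [okw])
  simp only [sh, SZ, List.map, List.nil_append, List.cons_append, List.append_nil,
    List.sum_cons, List.sum_nil, add_zero] at h
  rw [v_b, v_aacb] at h
  linear_combination -h

lemma r5_st_b_aacb :
    Z [b, a, a, b, c] - 2 * Z [a, a, c, b, c] + Z [a, a, c, a, c] - Z [a, a, a, b, c] = (7 / 4) *
    Real.log 2 ^ 2 * zetaVal 3 - (19 / 40) * Real.log 2 * zetaVal 2 ^ 2 := by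
  have h := stZ (0, false) (2, true) [(0, false)] Q_b_tendsto (by simp)
  simp only [ins, adx, SY, Y, sgn, sg, wordOf, lett, List.replicate, List.map, List.nil_append, List.cons_append, List.append_nil,
    List.sum_cons, List.sum_nil, add_zero,
    Bool.true_beq, Bool.false_beq, Bool.not_false, Bool.not_true, Nat.reduceAdd] at h
  rw [v_b, v_aacb] at h
  linear_combination -h

lemma r5_sh_b_aacc :
    Z [b, a, a, c, c] + Z [a, b, a, c, c] + Z [a, a, b, c, c] + Z [a, a, c, b, c] + Z [a, a, c, c,
    b] = (1 / 10) * Real.log 2 * zetaVal 2 ^ 2 := by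
  have h := shZ [b] [a, a, c, c] (by simp [good]) (by simp [good]) (by simp [okw]) (by simp [okw])
  simp only [sh, SZ, List.map, List.nil_append, List.cons_append, List.append_nil,
    List.sum_cons, List.sum_nil, add_zero] at h
  rw [v_b, v_aacc] at h
  linear_combination -h

lemma r5_st_b_aacc :
    Z [b, a, a, b, b] - Z [a, a, c, b, b] + Z [a, a, c, c, b] + Z [a, a, c, a, b] - Z [a, a, a, b,
    b] = (1 / 10) * Real.log 2 * zetaVal 2 ^ 2 := by
  have h := stZ (0, false) (2, true) [(0, true)] Q_b_tendsto (by simp)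
  simp only [ins, adx, SY, Y, sgn, sg, wordOf, lett, List.replicate, List.map, List.nil_append, List.cons_append, List.append_nil,
    List.sum_cons, List.sum_nil, add_zero,
    Bool.true_beq, Bool.false_beq, Bool.not_false, Bool.not_true, Nat.reduceAdd] at h
  rw [v_b, v_aacc] at h
  linear_combination h

lemma r5_sh_b_abab :
    Z [b, a, b, a, b] + 2 * Z [a, b, b, a, b] + 2 * Z [a, b, a, b, b] = -(7 / 2) * Real.log 2 ^ 2
    * zetaVal 3 - 4 * Real.log 2 * I [a, a, a, c] (1 / 2) + (13 / 8) * Real.log 2 * zetaVal 2 ^ 2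
    + Real.log 2 ^ 3 * zetaVal 2 - (1 / 6) * Real.log 2 ^ 5 := by
  have h := shZ [b] [a, b, a, b] (by simp [good]) (by simp [good]) (by simp [okw]) (by simp [okw])
  simp only [sh, SZ, List.map, List.nil_append, List.cons_append, List.append_nil,
    List.sum_cons, List.sum_nil, add_zero] at h
  rw [v_b, v_abab] at h
  linear_combination -h

lemma r5_st_b_abbb :
    -Z [b, a, c, c, c] - Z [a, b, c, c, c] + Z [a, b, b, c, c] - Z [a, b, b, b, c] + Z [a, b, b,
    a, c] - Z [a, b, a, c, c] + Z [a, a, c, c, c] = -(7 / 8) * Real.log 2 ^ 2 * zetaVal 3 + (1 /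
    4) * Real.log 2 ^ 3 * zetaVal 2 + (2 / 5) * Real.log 2 * zetaVal 2 ^ 2 - Real.log 2 * I [a, a,
    a, c] (1 / 2) - (1 / 24) * Real.log 2 ^ 5 := by
  have h := stZ (0, false) (1, false) [(0, true), (0, true)] Q_b_tendsto (by simp)
  simp only [ins, adx, SY, Y, sgn, sg, wordOf, lett, List.replicate, List.map, List.nil_append, List.cons_append, List.append_nil,
    List.sum_cons, List.sum_nil, add_zero,
    Bool.true_beq, Bool.false_beq, Bool.not_false, Bool.not_true, Nat.reduceAdd] at h
  rw [v_b, v_abbb] at h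
  linear_combination -h

lemma r5_sh_b_abbc :
    Z [b, a, b, b, c] + 3 * Z [a, b, b, b, c] + Z [a, b, b, c, b] = -(9 / 20) * Real.log 2 *
    zetaVal 2 ^ 2 + (1 / 4) * Real.log 2 ^ 3 * zetaVal 2 + (1 / 12) * Real.log 2 ^ 5 + 2 *
    Real.log 2 * I [a, a, a, c] (1 / 2) := by
  have h := shZ [b] [a, b, b, c] (by simp [good]) (by simp [good]) (by simp [okw]) (by simp [okw])
  simp only [sh, SZ, List.map, List.nil_append, List.cons_append, List.append_nil,
    List.sum_cons, List.sum_nil, add_zero] at h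
  rw [v_b, v_abbc] at h
  linear_combination -h

lemma r5_st_b_abbc :
    -Z [b, a, c, c, b] - Z [a, b, c, c, b] + 2 * Z [a, b, b, c, b] + Z [a, b, b, a, b] - Z [a, b,
    a, c, b] + Z [a, a, c, c, b] = -(9 / 20) * Real.log 2 * zetaVal 2 ^ 2 + (1 / 4) * Real.log 2 ^
    3 * zetaVal 2 + (1 / 12) * Real.log 2 ^ 5 + 2 * Real.log 2 * I [a, a, a, c] (1 / 2) := by
  have h := stZ (0, false) (1, false) [(0, true), (0, false)] Q_b_tendsto (by simp)
  simp only [ins, adx, SY, Y, sgn, sg, wordOf, lett, List.replicate, List.map, List.nil_append, List.cons_append, List.append_nil,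
    List.sum_cons, List.sum_nil, add_zero,
    Bool.true_beq, Bool.false_beq, Bool.not_false, Bool.not_true, Nat.reduceAdd] at h
  rw [v_b, v_abbc] at h
  linear_combination h

lemma r5_sh_b_abcb :
    Z [b, a, b, c, b] + 2 * Z [a, b, b, c, b] + 2 * Z [a, b, c, b, b] = -(3 / 2) * Real.log 2 ^ 3
    * zetaVal 2 + (21 / 8) * Real.log 2 ^ 2 * zetaVal 3 - (7 / 20) * Real.log 2 * zetaVal 2 ^ 2 :=
    by
  have h := shZ [b] [a, b, c, b] (by simp [good]) (by simp [good]) (by simp [okw]) (by simp [okw])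
  simp only [sh, SZ, List.map, List.nil_append, List.cons_append, List.append_nil,
    List.sum_cons, List.sum_nil, add_zero] at h
  rw [v_b, v_abcb] at h
  linear_combination -h

lemma r5_st_b_abcb :
    -Z [b, a, c, b, c] - 3 * Z [a, b, c, b, c] + Z [a, b, c, a, c] - Z [a, b, a, b, c] + Z [a, a,
    c, b, c] = -(3 / 2) * Real.log 2 ^ 3 * zetaVal 2 + (21 / 8) * Real.log 2 ^ 2 * zetaVal 3 - (7
    / 20) * Real.log 2 * zetaVal 2 ^ 2 := by
  have h := stZ (0, false) (1, false) [(0, false), (0, false)] Q_b_tendsto (by simp)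
  simp only [ins, adx, SY, Y, sgn, sg, wordOf, lett, List.replicate, List.map, List.nil_append, List.cons_append, List.append_nil,
    List.sum_cons, List.sum_nil, add_zero,
    Bool.true_beq, Bool.false_beq, Bool.not_false, Bool.not_true, Nat.reduceAdd] at h
  rw [v_b, v_abcb] at h
  linear_combination h

lemma r5_sh_b_abcc :
    Z [b, a, b, c, c] + 2 * Z [a, b, b, c, c] + Z [a, b, c, b, c] + Z [a, b, c, c, b] = -(11 / 20)
    * Real.log 2 * zetaVal 2 ^ 2 + (1 / 8) * Real.log 2 ^ 5 + 3 * Real.log 2 * I [a, a, a, c] (1 /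
    2) := by
  have h := shZ [b] [a, b, c, c] (by simp [good]) (by simp [good]) (by simp [okw]) (by simp [okw])
  simp only [sh, SZ, List.map, List.nil_append, List.cons_append, List.append_nil,
    List.sum_cons, List.sum_nil, add_zero] at h
  rw [v_b, v_abcc] at h
  linear_combination -h

lemma r5_st_b_abcc :
    -Z [b, a, c, b, b] - 2 * Z [a, b, c, b, b] + Z [a, b, c, c, b] + Z [a, b, c, a, b] - Z [a, b,
    a, b, b] + Z [a, a, c, b, b] = -(11 / 20) * Real.log 2 * zetaVal 2 ^ 2 + (1 / 8) * Real.log 2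
    ^ 5 + 3 * Real.log 2 * I [a, a, a, c] (1 / 2) := by
  have h := stZ (0, false) (1, false) [(0, false), (0, true)] Q_b_tendsto (by simp)
  simp only [ins, adx, SY, Y, sgn, sg, wordOf, lett, List.replicate, List.map, List.nil_append, List.cons_append, List.append_nil,
    List.sum_cons, List.sum_nil, add_zero,
    Bool.true_beq, Bool.false_beq, Bool.not_false, Bool.not_true, Nat.reduceAdd] at h
  rw [v_b, v_abcc] at h
  linear_combination -h

lemma r5_sh_b_acab :
    Z [b, a, c, a, b] + Z [a, b, c, a, b] + Z [a, c, b, a, b] + 2 * Z [a, c, a, b, b] = -(7 / 2) *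
    Real.log 2 ^ 2 * zetaVal 3 + Real.log 2 ^ 3 * zetaVal 2 + (71 / 40) * Real.log 2 * zetaVal 2 ^
    2 - (1 / 6) * Real.log 2 ^ 5 - 4 * Real.log 2 * I [a, a, a, c] (1 / 2) := by
  have h := shZ [b] [a, c, a, b] (by simp [good]) (by simp [good]) (by simp [okw]) (by simp [okw])
  simp only [sh, SZ, List.map, List.nil_append, List.cons_append, List.append_nil,
    List.sum_cons, List.sum_nil, add_zero] at h
  rw [v_b, v_acab] at h
  linear_combination -h

lemma r5_st_b_acab :
    Z [b, a, b, a, c] - Z [a, c, b, a, c] - Z [a, c, a, b, c] + Z [a, c, a, a, c] - Z [a, a, b, a,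
    c] = -(7 / 2) * Real.log 2 ^ 2 * zetaVal 3 + Real.log 2 ^ 3 * zetaVal 2 + (71 / 40) * Real.log
    2 * zetaVal 2 ^ 2 - (1 / 6) * Real.log 2 ^ 5 - 4 * Real.log 2 * I [a, a, a, c] (1 / 2) := by
  have h := stZ (0, false) (1, true) [(1, false)] Q_b_tendsto (by simp)
  simp only [ins, adx, SY, Y, sgn, sg, wordOf, lett, List.replicate, List.map, List.nil_append, List.cons_append, List.append_nil,
    List.sum_cons, List.sum_nil, add_zero,
    Bool.true_beq, Bool.false_beq, Bool.not_false, Bool.not_true, Nat.reduceAdd] at h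
  rw [v_b, v_acab] at h
  linear_combination -h

lemma r5_sh_b_acbb :
    Z [b, a, c, b, b] + Z [a, b, c, b, b] + 3 * Z [a, c, b, b, b] = (5 / 4) * Real.log 2 ^ 3 *
    zetaVal 2 - (21 / 8) * Real.log 2 ^ 2 * zetaVal 3 - 2 * Real.log 2 * I [a, a, a, c] (1 / 2) +
    (7 / 8) * Real.log 2 * zetaVal 2 ^ 2 - (1 / 12) * Real.log 2 ^ 5 := by
  have h := shZ [b] [a, c, b, b] (by simp [good]) (by simp [good]) (by simp [okw]) (by simp [okw])
  simp only [sh, SZ, List.map, List.nil_append, List.cons_append, List.append_nil,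
    List.sum_cons, List.sum_nil, add_zero] at h
  rw [v_b, v_acbb] at h
  linear_combination -h

lemma r5_st_b_acbb :
    -Z [b, a, b, c, c] + 2 * Z [a, c, b, c, c] - Z [a, c, b, b, c] + Z [a, c, b, a, c] - Z [a, c,
    a, c, c] + Z [a, a, b, c, c] = (5 / 4) * Real.log 2 ^ 3 * zetaVal 2 - (21 / 8) * Real.log 2 ^
    2 * zetaVal 3 - 2 * Real.log 2 * I [a, a, a, c] (1 / 2) + (7 / 8) * Real.log 2 * zetaVal 2 ^ 2
    - (1 / 12) * Real.log 2 ^ 5 := by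
  have h := stZ (0, false) (1, true) [(0, false), (0, true)] Q_b_tendsto (by simp)
  simp only [ins, adx, SY, Y, sgn, sg, wordOf, lett, List.replicate, List.map, List.nil_append, List.cons_append, List.append_nil,
    List.sum_cons, List.sum_nil, add_zero,
    Bool.true_beq, Bool.false_beq, Bool.not_false, Bool.not_true, Nat.reduceAdd] at h
  rw [v_b, v_acbb] at h
  linear_combination h

lemma r5_sh_b_acbc :
    Z [b, a, c, b, c] + Z [a, b, c, b, c] + 2 * Z [a, c, b, b, c] + Z [a, c, b, c, b] = -(3 / 4) *
    Real.log 2 ^ 3 * zetaVal 2 + (7 / 8) * Real.log 2 * zetaVal 2 ^ 2 - (1 / 8) * Real.log 2 ^ 5 -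
    3 * Real.log 2 * I [a, a, a, c] (1 / 2) := by
  have h := shZ [b] [a, c, b, c] (by simp [good]) (by simp [good]) (by simp [okw]) (by simp [okw])
  simp only [sh, SZ, List.map, List.nil_append, List.cons_append, List.append_nil,
    List.sum_cons, List.sum_nil, add_zero] at h
  rw [v_b, v_acbc] at h
  linear_combination -h

lemma r5_st_b_acbc :
    -Z [b, a, b, c, b] + 3 * Z [a, c, b, c, b] + Z [a, c, b, a, b] - Z [a, c, a, c, b] + Z [a, a,
    b, c, b] = -(3 / 4) * Real.log 2 ^ 3 * zetaVal 2 + (7 / 8) * Real.log 2 * zetaVal 2 ^ 2 - (1 /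
    8) * Real.log 2 ^ 5 - 3 * Real.log 2 * I [a, a, a, c] (1 / 2) := by
  have h := stZ (0, false) (1, true) [(0, false), (0, false)] Q_b_tendsto (by simp)
  simp only [ins, adx, SY, Y, sgn, sg, wordOf, lett, List.replicate, List.map, List.nil_append, List.cons_append, List.append_nil,
    List.sum_cons, List.sum_nil, add_zero,
    Bool.true_beq, Bool.false_beq, Bool.not_false, Bool.not_true, Nat.reduceAdd] at h
  rw [v_b, v_acbc] at h
  linear_combination -h

lemma r5_sh_b_accb :
    Z [b, a, c, c, b] + Z [a, b, c, c, b] + Z [a, c, b, c, b] + 2 * Z [a, c, c, b, b] = (7 / 8) *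
    Real.log 2 ^ 2 * zetaVal 3 - (9 / 20) * Real.log 2 * zetaVal 2 ^ 2 + (1 / 2) * Real.log 2 ^ 3
    * zetaVal 2 + Real.log 2 * I [a, a, a, c] (1 / 2) + (1 / 24) * Real.log 2 ^ 5 := by
  have h := shZ [b] [a, c, c, b] (by simp [good]) (by simp [good]) (by simp [okw]) (by simp [okw])
  simp only [sh, SZ, List.map, List.nil_append, List.cons_append, List.append_nil,
    List.sum_cons, List.sum_nil, add_zero] at h
  rw [v_b, v_accb] at h
  linear_combination -h

lemma r5_st_b_accb :
    -Z [b, a, b, b, c] + Z [a, c, b, b, c] - 2 * Z [a, c, c, b, c] + Z [a, c, c, a, c] - Z [a, c,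
    a, b, c] + Z [a, a, b, b, c] = (7 / 8) * Real.log 2 ^ 2 * zetaVal 3 - (9 / 20) * Real.log 2 *
    zetaVal 2 ^ 2 + (1 / 2) * Real.log 2 ^ 3 * zetaVal 2 + Real.log 2 * I [a, a, a, c] (1 / 2) +
    (1 / 24) * Real.log 2 ^ 5 := by
  have h := stZ (0, false) (1, true) [(0, true), (0, false)] Q_b_tendsto (by simp)
  simp only [ins, adx, SY, Y, sgn, sg, wordOf, lett, List.replicate, List.map, List.nil_append, List.cons_append, List.append_nil,
    List.sum_cons, List.sum_nil, add_zero,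
    Bool.true_beq, Bool.false_beq, Bool.not_false, Bool.not_true, Nat.reduceAdd] at h
  rw [v_b, v_accb] at h
  linear_combination -h

lemma r5_sh_b_accc :
    Z [b, a, c, c, c] + Z [a, b, c, c, c] + Z [a, c, b, c, c] + Z [a, c, c, b, c] + Z [a, c, c, c,
    b] = (2 / 5) * Real.log 2 * zetaVal 2 ^ 2 := by
  have h := shZ [b] [a, c, c, c] (by simp [good]) (by simp [good]) (by simp [okw]) (by simp [okw])
  simp only [sh, SZ, List.map, List.nil_append, List.cons_append, List.append_nil,
    List.sum_cons, List.sum_nil, add_zero] at h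
  rw [v_b, v_accc] at h
  linear_combination -h

lemma r5_st_b_accc :
    -Z [b, a, b, b, b] + Z [a, c, b, b, b] - Z [a, c, c, b, b] + Z [a, c, c, c, b] + Z [a, c, c,
    a, b] - Z [a, c, a, b, b] + Z [a, a, b, b, b] = (2 / 5) * Real.log 2 * zetaVal 2 ^ 2 := by
  have h := stZ (0, false) (1, true) [(0, true), (0, true)] Q_b_tendsto (by simp)
  simp only [ins, adx, SY, Y, sgn, sg, wordOf, lett, List.replicate, List.map, List.nil_append, List.cons_append, List.append_nil,
    List.sum_cons, List.sum_nil, add_zero,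
    Bool.true_beq, Bool.false_beq, Bool.not_false, Bool.not_true, Nat.reduceAdd] at h
  rw [v_b, v_accc] at h
  linear_combination h

lemma r5_sh_b_baab :
    2 * Z [b, b, a, a, b] + Z [b, a, b, a, b] + 2 * Z [b, a, a, b, b] = (3 / 4) * Real.log 2 ^ 2 *
    zetaVal 3 - (1 / 8) * Real.log 2 * zetaVal 2 ^ 2 := by
  have h := shZ [b] [b, a, a, b] (by simp [good]) (by simp [good]) (by simp [okw]) (by simp [okw])
  simp only [sh, SZ, List.map, List.nil_append, List.cons_append, List.append_nil,
    List.sum_cons, List.sum_nil, add_zero] at h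
  rw [v_b, v_baab] at h
  linear_combination -h

lemma r5_sh_b_baac :
    2 * Z [b, b, a, a, c] + Z [b, a, b, a, c] + Z [b, a, a, b, c] + Z [b, a, a, c, b] = -(3 / 4) *
    Real.log 2 ^ 2 * zetaVal 3 - (1 / 12) * Real.log 2 ^ 5 + (1 / 2) * Real.log 2 ^ 3 * zetaVal 2
    + (3 / 5) * Real.log 2 * zetaVal 2 ^ 2 - 2 * Real.log 2 * I [a, a, a, c] (1 / 2) := by
  have h := shZ [b] [b, a, a, c] (by simp [good]) (by simp [good]) (by simp [okw]) (by simp [okw])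
  simp only [sh, SZ, List.map, List.nil_append, List.cons_append, List.append_nil,
    List.sum_cons, List.sum_nil, add_zero] at h
  rw [v_b, v_baac] at h
  linear_combination -h

lemma r5_sh_b_babb :
    2 * Z [b, b, a, b, b] + 3 * Z [b, a, b, b, b] = -(3 / 4) * Real.log 2 ^ 3 * zetaVal 2 + (11 /
    4) * Real.log 2 ^ 2 * zetaVal 3 - (6 / 5) * Real.log 2 * zetaVal 2 ^ 2 + 3 * Real.log 2 * I
    [a, a, a, c] (1 / 2) + (1 / 8) * Real.log 2 ^ 5 := by
  have h := shZ [b] [b, a, b, b] (by simp [good]) (by simp [good]) (by simp [okw]) (by simp [okw])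
  simp only [sh, SZ, List.map, List.nil_append, List.cons_append, List.append_nil,
    List.sum_cons, List.sum_nil, add_zero] at h
  rw [v_b, v_babb] at h
  linear_combination -h

lemma r5_sh_b_bbab :
    3 * Z [b, b, b, a, b] + 2 * Z [b, b, a, b, b] = (6 / 5) * Real.log 2 * zetaVal 2 ^ 2 +
    Real.log 2 ^ 3 * zetaVal 2 - (23 / 8) * Real.log 2 ^ 2 * zetaVal 3 - 3 * Real.log 2 * I [a, a,
    a, c] (1 / 2) - (1 / 8) * Real.log 2 ^ 5 := by
  have h := shZ [b] [b, b, a, b] (by simp [good]) (by simp [good]) (by simp [okw]) (by simp [okw])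
  simp only [sh, SZ, List.map, List.nil_append, List.cons_append, List.append_nil,
    List.sum_cons, List.sum_nil, add_zero] at h
  rw [v_b, v_bbab] at h
  linear_combination -h

lemma r5_sh_ab_aab :
    Z [a, b, a, a, b] + 3 * Z [a, a, b, a, b] + 6 * Z [a, a, a, b, b] = (3 / 8) * zetaVal 2 *
    zetaVal 3 := by
  have h := shZ [a, b] [a, a, b] (by simp [good]) (by simp [good]) (by simp [okw]) (by simp [okw])
  simp only [sh, SZ, List.map, List.nil_append, List.cons_append, List.append_nil,
    List.sum_cons, List.sum_nil, add_zero] at h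
  rw [v_ab, v_aab] at h
  linear_combination -h

lemma r5_st_ab_aab :
    -Z [a, b, a, a, c] - Z [a, a, b, a, c] + Z [a, a, a, a, c] = (3 / 8) * zetaVal 2 * zetaVal 3
    := by
  have h := stZ (1, false) (2, false) [] (Q_tendsto 0 false []) (by simp)
  simp only [ins, adx, SY, Y, sgn, sg, wordOf, lett, List.replicate, List.map, List.nil_append, List.cons_append, List.append_nil,
    List.sum_cons, List.sum_nil, add_zero,
    Bool.true_beq, Bool.false_beq, Bool.not_false, Bool.not_true, Nat.reduceAdd] at h
  rw [v_ab, v_aab] at h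
  linear_combination -h

lemma r5_sh_ab_aac :
    Z [a, b, a, a, c] + 2 * Z [a, a, b, a, c] + 3 * Z [a, a, a, b, c] + 3 * Z [a, a, a, c, b] + Z
    [a, a, c, a, b] = (1 / 2) * zetaVal 2 * zetaVal 3 := by
  have h := shZ [a, b] [a, a, c] (by simp [good]) (by simp [good]) (by simp [okw]) (by simp [okw])
  simp only [sh, SZ, List.map, List.nil_append, List.cons_append, List.append_nil,
    List.sum_cons, List.sum_nil, add_zero] at h
  rw [v_ab, v_aac] at h
  linear_combination -h

lemma r5_st_ab_aac :
    -Z [a, b, a, a, b] + Z [a, a, c, a, b] + Z [a, a, a, a, b] = (1 / 2) * zetaVal 2 * zetaVal 3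
    := by
  have h := stZ (1, false) (2, true) [] (Q_tendsto 0 false []) (by simp)
  simp only [ins, adx, SY, Y, sgn, sg, wordOf, lett, List.replicate, List.map, List.nil_append, List.cons_append, List.append_nil,
    List.sum_cons, List.sum_nil, add_zero,
    Bool.true_beq, Bool.false_beq, Bool.not_false, Bool.not_true, Nat.reduceAdd] at h
  rw [v_ab, v_aac] at h
  linear_combination h

lemma r5_sh_ab_abb :
    3 * Z [a, b, a, b, b] + 6 * Z [a, a, b, b, b] + Z [a, b, b, a, b] = (1 / 16) * zetaVal 2 *
    zetaVal 3 := by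
  have h := shZ [a, b] [a, b, b] (by simp [good]) (by simp [good]) (by simp [okw]) (by simp [okw])
  simp only [sh, SZ, List.map, List.nil_append, List.cons_append, List.append_nil,
    List.sum_cons, List.sum_nil, add_zero] at h
  rw [v_ab, v_abb] at h
  linear_combination -h

lemma r5_st_ab_abb :
    2 * Z [a, b, a, c, c] - Z [a, b, b, a, c] + Z [a, b, a, a, c] - Z [a, a, a, c, c] = (1 / 16) *
    zetaVal 2 * zetaVal 3 := by
  have h := stZ (1, false) (1, false) [(0, true)] (Q_tendsto 0 false []) (by simp)
  simp only [ins, adx, SY, Y, sgn, sg, wordOf, lett, List.replicate, List.map, List.nil_append, List.cons_append, List.append_nil,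
    List.sum_cons, List.sum_nil, add_zero,
    Bool.true_beq, Bool.false_beq, Bool.not_false, Bool.not_true, Nat.reduceAdd] at h
  rw [v_ab, v_abb] at h
  linear_combination h

lemma r5_sh_ab_abc :
    2 * Z [a, b, a, b, c] + 4 * Z [a, a, b, b, c] + 2 * Z [a, a, b, c, b] + Z [a, b, a, c, b] + Z
    [a, b, c, a, b] = -(3 / 4) * Real.log 2 * zetaVal 2 ^ 2 + (13 / 16) * zetaVal 2 * zetaVal 3 :=
    by
  have h := shZ [a, b] [a, b, c] (by simp [good]) (by simp [good]) (by simp [okw]) (by simp [okw])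
  simp only [sh, SZ, List.map, List.nil_append, List.cons_append, List.append_nil,
    List.sum_cons, List.sum_nil, add_zero] at h
  rw [v_ab, v_abc] at h
  linear_combination -h

lemma r5_st_ab_abc :
    2 * Z [a, b, a, c, b] + Z [a, b, c, a, b] + Z [a, b, a, a, b] - Z [a, a, a, c, b] = -(3 / 4) *
    Real.log 2 * zetaVal 2 ^ 2 + (13 / 16) * zetaVal 2 * zetaVal 3 := by
  have h := stZ (1, false) (1, false) [(0, false)] (Q_tendsto 0 false []) (by simp)
  simp only [ins, adx, SY, Y, sgn, sg, wordOf, lett, List.replicate, List.map, List.nil_append, List.cons_append, List.append_nil,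
    List.sum_cons, List.sum_nil, add_zero,
    Bool.true_beq, Bool.false_beq, Bool.not_false, Bool.not_true, Nat.reduceAdd] at h
  rw [v_ab, v_abc] at h
  linear_combination -h

lemma r5_sh_ab_acb :
    Z [a, b, a, c, b] + 2 * Z [a, a, b, c, b] + 4 * Z [a, a, c, b, b] + 2 * Z [a, c, a, b, b] + Z
    [a, c, b, a, b] = (3 / 4) * Real.log 2 * zetaVal 2 ^ 2 - (1 / 2) * zetaVal 2 * zetaVal 3 := by
  have h := shZ [a, b] [a, c, b] (by simp [good]) (by simp [good]) (by simp [okw]) (by simp [okw])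
  simp only [sh, SZ, List.map, List.nil_append, List.cons_append, List.append_nil,
    List.sum_cons, List.sum_nil, add_zero] at h
  rw [v_ab, v_acb] at h
  linear_combination -h

lemma r5_st_ab_acc :
    Z [a, b, a, b, b] - Z [a, c, a, b, b] + Z [a, c, c, a, b] + Z [a, c, a, a, b] - Z [a, a, a, b,
    b] = (1 / 2) * zetaVal 2 * zetaVal 3 := by
  have h := stZ (1, false) (1, true) [(0, true)] (Q_tendsto 0 false []) (by simp)
  simp only [ins, adx, SY, Y, sgn, sg, wordOf, lett, List.replicate, List.map, List.nil_append, List.cons_append, List.append_nil,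
    List.sum_cons, List.sum_nil, add_zero,
    Bool.true_beq, Bool.false_beq, Bool.not_false, Bool.not_true, Nat.reduceAdd] at h
  rw [v_ab, v_acc] at h
  linear_combination h

lemma r5_sh_ab_bac :
    2 * Z [a, b, b, a, c] + Z [a, b, a, b, c] + Z [a, b, a, c, b] + Z [b, a, b, a, c] + 2 * Z [b,
    a, a, b, c] + 2 * Z [b, a, a, c, b] + Z [b, a, c, a, b] = (1 / 2) * Real.log 2 * zetaVal 2 ^ 2
    - (5 / 16) * zetaVal 2 * zetaVal 3 := by
  have h := shZ [a, b] [b, a, c] (by simp [good]) (by simp [good]) (by simp [okw]) (by simp [okw])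
  simp only [sh, SZ, List.map, List.nil_append, List.cons_append, List.append_nil,
    List.sum_cons, List.sum_nil, add_zero] at h
  rw [v_ab, v_bac] at h
  linear_combination -h

lemma r5_sh_ab_bbb :
    4 * Z [a, b, b, b, b] + 3 * Z [b, a, b, b, b] + 2 * Z [b, b, a, b, b] + Z [b, b, b, a, b] = (1
    / 12) * Real.log 2 ^ 3 * zetaVal 2 := by
  have h := shZ [a, b] [b, b, b] (by simp [good]) (by simp [good]) (by simp [okw]) (by simp [okw])
  simp only [sh, SZ, List.map, List.nil_append, List.cons_append, List.append_nil,
    List.sum_cons, List.sum_nil, add_zero] at h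
  rw [v_ab, v_bbb] at h
  linear_combination -h

lemma r5_sh_ac_aab :
    Z [a, c, a, a, b] + 2 * Z [a, a, c, a, b] + 3 * Z [a, a, a, c, b] + 3 * Z [a, a, a, b, c] + Z
    [a, a, b, a, c] = (3 / 4) * zetaVal 2 * zetaVal 3 := by
  have h := shZ [a, c] [a, a, b] (by simp [good]) (by simp [good]) (by simp [okw]) (by simp [okw])
  simp only [sh, SZ, List.map, List.nil_append, List.cons_append, List.append_nil,
    List.sum_cons, List.sum_nil, add_zero] at h
  rw [v_ac, v_aab] at h
  linear_combination -h

lemma r5_st_ac_aab :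
    Z [a, c, a, a, b] - Z [a, a, b, a, b] + Z [a, a, a, a, b] = (3 / 4) * zetaVal 2 * zetaVal 3 :=
    by
  have h := stZ (1, true) (2, false) [] (Q_tendsto 0 true []) (by simp)
  simp only [ins, adx, SY, Y, sgn, sg, wordOf, lett, List.replicate, List.map, List.nil_append, List.cons_append, List.append_nil,
    List.sum_cons, List.sum_nil, add_zero,
    Bool.true_beq, Bool.false_beq, Bool.not_false, Bool.not_true, Nat.reduceAdd] at h
  rw [v_ac, v_aab] at h
  linear_combination h

lemma r5_sh_ac_abb :
    Z [a, c, a, b, b] + 2 * Z [a, a, c, b, b] + 2 * Z [a, a, b, c, b] + 2 * Z [a, a, b, b, c] + Z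
    [a, b, a, c, b] + Z [a, b, a, b, c] + Z [a, b, b, a, c] = (1 / 8) * zetaVal 2 * zetaVal 3 :=
    by
  have h := shZ [a, c] [a, b, b] (by simp [good]) (by simp [good]) (by simp [okw]) (by simp [okw])
  simp only [sh, SZ, List.map, List.nil_append, List.cons_append, List.append_nil,
    List.sum_cons, List.sum_nil, add_zero] at h
  rw [v_ac, v_abb] at h
  linear_combination -h

lemma r5_sh_ac_abc :
    Z [a, c, a, b, c] + 2 * Z [a, a, c, b, c] + 4 * Z [a, a, b, c, c] + 2 * Z [a, b, a, c, c] + Z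
    [a, b, c, a, c] = -(3 / 2) * Real.log 2 * zetaVal 2 ^ 2 + (13 / 8) * zetaVal 2 * zetaVal 3 :=
    by
  have h := shZ [a, c] [a, b, c] (by simp [good]) (by simp [good]) (by simp [okw]) (by simp [okw])
  simp only [sh, SZ, List.map, List.nil_append, List.cons_append, List.append_nil,
    List.sum_cons, List.sum_nil, add_zero] at h
  rw [v_ac, v_abc] at h
  linear_combination -h

lemma r5_st_ac_abc :
    Z [a, c, a, b, c] - Z [a, b, a, b, c] + Z [a, b, c, a, c] + Z [a, b, a, a, c] + Z [a, a, a, b,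
    c] = -(3 / 2) * Real.log 2 * zetaVal 2 ^ 2 + (13 / 8) * zetaVal 2 * zetaVal 3 := by
  have h := stZ (1, true) (1, false) [(0, false)] (Q_tendsto 0 true []) (by simp)
  simp only [ins, adx, SY, Y, sgn, sg, wordOf, lett, List.replicate, List.map, List.nil_append, List.cons_append, List.append_nil,
    List.sum_cons, List.sum_nil, add_zero,
    Bool.true_beq, Bool.false_beq, Bool.not_false, Bool.not_true, Nat.reduceAdd] at h
  rw [v_ac, v_abc] at h
  linear_combination h

lemma r5_sh_ac_acb :
    2 * Z [a, c, a, c, b] + 4 * Z [a, a, c, c, b] + 2 * Z [a, a, c, b, c] + Z [a, c, a, b, c] + Z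
    [a, c, b, a, c] = (3 / 2) * Real.log 2 * zetaVal 2 ^ 2 - zetaVal 2 * zetaVal 3 := by
  have h := shZ [a, c] [a, c, b] (by simp [good]) (by simp [good]) (by simp [okw]) (by simp [okw])
  simp only [sh, SZ, List.map, List.nil_append, List.cons_append, List.append_nil,
    List.sum_cons, List.sum_nil, add_zero] at h
  rw [v_ac, v_acb] at h
  linear_combination -h

lemma r5_sh_ac_acc :
    3 * Z [a, c, a, c, c] + 6 * Z [a, a, c, c, c] + Z [a, c, c, a, c] = zetaVal 2 * zetaVal 3 :=
    by
  have h := shZ [a, c] [a, c, c] (by simp [good]) (by simp [good]) (by simp [okw]) (by simp [okw])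
  simp only [sh, SZ, List.map, List.nil_append, List.cons_append, List.append_nil,
    List.sum_cons, List.sum_nil, add_zero] at h
  rw [v_ac, v_acc] at h
  linear_combination -h

lemma r5_sh_bb_aac :
    Z [b, b, a, a, c] + Z [b, a, b, a, c] + Z [b, a, a, b, c] + Z [b, a, a, c, b] + Z [a, b, b, a,
    c] + Z [a, b, a, b, c] + Z [a, b, a, c, b] + Z [a, a, b, b, c] + Z [a, a, b, c, b] + Z [a, a,
    c, b, b] = (1 / 2) * Real.log 2 ^ 2 * zetaVal 3 := by
  have h := shZ [b, b] [a, a, c] (by simp [good]) (by simp [good]) (by simp [okw]) (by simp [okw])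
  simp only [sh, SZ, List.map, List.nil_append, List.cons_append, List.append_nil,
    List.sum_cons, List.sum_nil, add_zero] at h
  rw [v_bb, v_aac] at h
  linear_combination -h

lemma r5_sh_bb_bbb :
    10 * Z [b, b, b, b, b] = (1 / 12) * Real.log 2 ^ 5 := by
  have h := shZ [b, b] [b, b, b] (by simp [good]) (by simp [good]) (by simp [okw]) (by simp [okw])
  simp only [sh, SZ, List.map, List.nil_append, List.cons_append, List.append_nil,
    List.sum_cons, List.sum_nil, add_zero] at h
  rw [v_bb, v_bbb] at h
  linear_combination -h

lemma r5_reg_aaab :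
    Z [a, c, a, a, b] + Z [a, a, c, a, b] + Z [a, a, a, c, b] + Z [a, a, a, b, c] + Z [a, a, a, b,
    b] - Z [a, a, a, a, b] = 0 := by
  have h := regZ 2 false [] [a, a, b] rfl (by simp [good])
  simp only [insR, ins, adx, SY, Y, sgn, sg, wordOf, lett, List.replicate, sh, SZ, List.map, List.nil_append, List.cons_append, List.append_nil,
    List.sum_cons, List.sum_nil, add_zero,
    Bool.true_beq, Bool.false_beq, Bool.not_false, Bool.not_true, Nat.reduceAdd] at h
  linear_combination h

lemma r5_reg_aaac :
    Z [a, c, a, a, c] + Z [a, a, c, a, c] + Z [a, a, a, c, c] - Z [a, a, a, a, c] = 0 := by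
  have h := regZ 2 true [] [a, a, c] rfl (by simp [good])
  simp only [insR, ins, adx, SY, Y, sgn, sg, wordOf, lett, List.replicate, sh, SZ, List.map, List.nil_append, List.cons_append, List.append_nil,
    List.sum_cons, List.sum_nil, add_zero,
    Bool.true_beq, Bool.false_beq, Bool.not_false, Bool.not_true, Nat.reduceAdd] at h
  linear_combination h

lemma r5_reg_aabb :
    Z [a, c, a, b, b] + Z [a, a, c, b, b] + Z [a, a, b, c, b] + Z [a, a, b, b, c] + 2 * Z [a, a,
    b, b, b] - Z [a, a, b, a, b] - Z [a, a, a, b, b] = 0 := by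
  have h := regZ 1 false [(0, true)] [a, b, b] rfl (by simp [good])
  simp only [insR, ins, adx, SY, Y, sgn, sg, wordOf, lett, List.replicate, sh, SZ, List.map, List.nil_append, List.cons_append, List.append_nil,
    List.sum_cons, List.sum_nil, add_zero,
    Bool.true_beq, Bool.false_beq, Bool.not_false, Bool.not_true, Nat.reduceAdd] at h
  linear_combination h

lemma r5_reg_aabc :
    Z [a, c, a, b, c] + Z [a, a, c, b, c] + Z [a, a, b, c, c] + Z [a, a, b, b, c] - Z [a, a, b, a,
    c] - Z [a, a, a, b, c] = 0 := by
  have h := regZ 1 false [(0, false)] [a, b, c] rfl (by simp [good])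
  simp only [insR, ins, adx, SY, Y, sgn, sg, wordOf, lett, List.replicate, sh, SZ, List.map, List.nil_append, List.cons_append, List.append_nil,
    List.sum_cons, List.sum_nil, add_zero,
    Bool.true_beq, Bool.false_beq, Bool.not_false, Bool.not_true, Nat.reduceAdd] at h
  linear_combination h

lemma r5_reg_aacc :
    Z [a, c, a, c, c] + Z [a, a, c, c, c] - Z [a, a, c, a, c] - Z [a, a, a, c, c] = 0 := by
  have h := regZ 1 true [(0, true)] [a, c, c] rfl (by simp [good])
  simp only [insR, ins, adx, SY, Y, sgn, sg, wordOf, lett, List.replicate, sh, SZ, List.map, List.nil_append, List.cons_append, List.append_nil,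
    List.sum_cons, List.sum_nil, add_zero,
    Bool.true_beq, Bool.false_beq, Bool.not_false, Bool.not_true, Nat.reduceAdd] at h
  linear_combination h

lemma r5_reg_abbb :
    Z [a, c, b, b, b] + Z [a, b, c, b, b] + Z [a, b, b, c, b] + Z [a, b, b, b, c] + 3 * Z [a, b,
    b, b, b] - Z [a, b, b, a, b] - Z [a, b, a, b, b] - Z [a, a, b, b, b] = 0 := by
  have h := regZ 0 false [(0, true), (0, true)] [b, b, b] rfl (by simp [good])
  simp only [insR, ins, adx, SY, Y, sgn, sg, wordOf, lett, List.replicate, sh, SZ, List.map, List.nil_append, List.cons_append, List.append_nil,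
    List.sum_cons, List.sum_nil, add_zero,
    Bool.true_beq, Bool.false_beq, Bool.not_false, Bool.not_true, Nat.reduceAdd] at h
  linear_combination h

lemma r5_reg_abbc :
    Z [a, c, b, b, c] + Z [a, b, c, b, c] + Z [a, b, b, c, c] + 2 * Z [a, b, b, b, c] - Z [a, b,
    b, a, c] - Z [a, b, a, b, c] - Z [a, a, b, b, c] = 0 := by
  have h := regZ 0 false [(0, true), (0, false)] [b, b, c] rfl (by simp [good])
  simp only [insR, ins, adx, SY, Y, sgn, sg, wordOf, lett, List.replicate, sh, SZ, List.map, List.nil_append, List.cons_append, List.append_nil,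
    List.sum_cons, List.sum_nil, add_zero,
    Bool.true_beq, Bool.false_beq, Bool.not_false, Bool.not_true, Nat.reduceAdd] at h
  linear_combination h

lemma r5_reg_abcb :
    Z [a, c, b, c, b] + Z [a, b, c, c, b] + Z [a, b, c, b, c] + Z [a, b, b, c, b] + Z [a, b, c, b,
    b] - Z [a, b, c, a, b] - Z [a, b, a, c, b] - Z [a, a, b, c, b] = 0 := by
  have h := regZ 0 false [(0, false), (0, false)] [b, c, b] rfl (by simp [good])
  simp only [insR, ins, adx, SY, Y, sgn, sg, wordOf, lett, List.replicate, sh, SZ, List.map, List.nil_append, List.cons_append, List.append_nil,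
    List.sum_cons, List.sum_nil, add_zero,
    Bool.true_beq, Bool.false_beq, Bool.not_false, Bool.not_true, Nat.reduceAdd] at h
  linear_combination h

lemma r5_reg_acab :
    Z [a, c, c, a, b] + Z [a, c, a, c, b] + Z [a, c, a, b, c] + Z [a, c, a, b, b] - Z [a, c, a, a,
    b] - Z [a, a, c, a, b] = 0 := by
  have h := regZ 0 true [(1, false)] [c, a, b] rfl (by simp [good])
  simp only [insR, ins, adx, SY, Y, sgn, sg, wordOf, lett, List.replicate, sh, SZ, List.map, List.nil_append, List.cons_append, List.append_nil,
    List.sum_cons, List.sum_nil, add_zero,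
    Bool.true_beq, Bool.false_beq, Bool.not_false, Bool.not_true, Nat.reduceAdd] at h
  linear_combination h

lemma r5_reg_acbb :
    Z [a, c, c, b, b] + Z [a, c, b, c, b] + Z [a, c, b, b, c] + 2 * Z [a, c, b, b, b] - Z [a, c,
    b, a, b] - Z [a, c, a, b, b] - Z [a, a, c, b, b] = 0 := by
  have h := regZ 0 true [(0, false), (0, true)] [c, b, b] rfl (by simp [good])
  simp only [insR, ins, adx, SY, Y, sgn, sg, wordOf, lett, List.replicate, sh, SZ, List.map, List.nil_append, List.cons_append, List.append_nil,
    List.sum_cons, List.sum_nil, add_zero,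
    Bool.true_beq, Bool.false_beq, Bool.not_false, Bool.not_true, Nat.reduceAdd] at h
  linear_combination h

lemma r5_reg_acbc :
    Z [a, c, c, b, c] + Z [a, c, b, c, c] + Z [a, c, b, b, c] - Z [a, c, b, a, c] - Z [a, c, a, b,
    c] - Z [a, a, c, b, c] = 0 := by
  have h := regZ 0 true [(0, false), (0, false)] [c, b, c] rfl (by simp [good])
  simp only [insR, ins, adx, SY, Y, sgn, sg, wordOf, lett, List.replicate, sh, SZ, List.map, List.nil_append, List.cons_append, List.append_nil,
    List.sum_cons, List.sum_nil, add_zero,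
    Bool.true_beq, Bool.false_beq, Bool.not_false, Bool.not_true, Nat.reduceAdd] at h
  linear_combination h

lemma r5_reg_accb :
    Z [a, c, c, c, b] + Z [a, c, c, b, c] + Z [a, c, c, b, b] - Z [a, c, c, a, b] - Z [a, c, a, c,
    b] - Z [a, a, c, c, b] = 0 := by
  have h := regZ 0 true [(0, true), (0, false)] [c, c, b] rfl (by simp [good])
  simp only [insR, ins, adx, SY, Y, sgn, sg, wordOf, lett, List.replicate, sh, SZ, List.map, List.nil_append, List.cons_append, List.append_nil,
    List.sum_cons, List.sum_nil, add_zero,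
    Bool.true_beq, Bool.false_beq, Bool.not_false, Bool.not_true, Nat.reduceAdd] at h
  linear_combination h

lemma r5_sq_aaaac :
    15 * Z [a, a, a, a, c] - 16 * Z [a, a, a, a, b] = 0 := by
  have h := sqZ [a, a, a, a, c] (by simp [good]) (by simp [noB]) (by simp [okw])
    (by simp [sub, pres, pre, mSQ, okw])
  simp only [sub, pres, pre, mSQ, LZ, List.map, List.nil_append, List.cons_append, List.append_nil,
    List.sum_cons, List.sum_nil, add_zero] at h
  linear_combination -h

lemma r5_sq_aaacc :
    7 * Z [a, a, a, c, c] - 8 * Z [a, a, a, c, b] - 8 * Z [a, a, a, b, c] + 8 * Z [a, a, a, b, b]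
    = 0 := by
  have h := sqZ [a, a, a, c, c] (by simp [good]) (by simp [noB]) (by simp [okw])
    (by simp [sub, pres, pre, mSQ, okw])
  simp only [sub, pres, pre, mSQ, LZ, List.map, List.nil_append, List.cons_append, List.append_nil,
    List.sum_cons, List.sum_nil, add_zero] at h
  linear_combination -h

lemma r5_sq_aacac :
    7 * Z [a, a, c, a, c] - 8 * Z [a, a, c, a, b] - 8 * Z [a, a, b, a, c] + 8 * Z [a, a, b, a, b]
    = 0 := by
  have h := sqZ [a, a, c, a, c] (by simp [good]) (by simp [noB]) (by simp [okw])
    (by simp [sub, pres, pre, mSQ, okw])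
  simp only [sub, pres, pre, mSQ, LZ, List.map, List.nil_append, List.cons_append, List.append_nil,
    List.sum_cons, List.sum_nil, add_zero] at h
  linear_combination -h

lemma r5_sq_aaccc :
    3 * Z [a, a, c, c, c] - 4 * Z [a, a, c, c, b] - 4 * Z [a, a, c, b, c] + 4 * Z [a, a, c, b, b]
    - 4 * Z [a, a, b, c, c] + 4 * Z [a, a, b, c, b] + 4 * Z [a, a, b, b, c] - 4 * Z [a, a, b, b,
    b] = 0 := by
  have h := sqZ [a, a, c, c, c] (by simp [good]) (by simp [noB]) (by simp [okw])
    (by simp [sub, pres, pre, mSQ, okw])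
  simp only [sub, pres, pre, mSQ, LZ, List.map, List.nil_append, List.cons_append, List.append_nil,
    List.sum_cons, List.sum_nil, add_zero] at h
  linear_combination -h

lemma r5_sq_acaac :
    7 * Z [a, c, a, a, c] - 8 * Z [a, c, a, a, b] - 8 * Z [a, b, a, a, c] + 8 * Z [a, b, a, a, b]
    = 0 := by
  have h := sqZ [a, c, a, a, c] (by simp [good]) (by simp [noB]) (by simp [okw])
    (by simp [sub, pres, pre, mSQ, okw])
  simp only [sub, pres, pre, mSQ, LZ, List.map, List.nil_append, List.cons_append, List.append_nil,
    List.sum_cons, List.sum_nil, add_zero] at h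
  linear_combination -h

lemma r5_sq_acacc :
    3 * Z [a, c, a, c, c] - 4 * Z [a, c, a, c, b] - 4 * Z [a, c, a, b, c] + 4 * Z [a, c, a, b, b]
    - 4 * Z [a, b, a, c, c] + 4 * Z [a, b, a, c, b] + 4 * Z [a, b, a, b, c] - 4 * Z [a, b, a, b,
    b] = 0 := by
  have h := sqZ [a, c, a, c, c] (by simp [good]) (by simp [noB]) (by simp [okw])
    (by simp [sub, pres, pre, mSQ, okw])
  simp only [sub, pres, pre, mSQ, LZ, List.map, List.nil_append, List.cons_append, List.append_nil,
    List.sum_cons, List.sum_nil, add_zero] at h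
  linear_combination -h

lemma r5_sq_accac :
    3 * Z [a, c, c, a, c] - 4 * Z [a, c, c, a, b] - 4 * Z [a, c, b, a, c] + 4 * Z [a, c, b, a, b]
    - 4 * Z [a, b, c, a, c] + 4 * Z [a, b, c, a, b] + 4 * Z [a, b, b, a, c] - 4 * Z [a, b, b, a,
    b] = 0 := by
  have h := sqZ [a, c, c, a, c] (by simp [good]) (by simp [noB]) (by simp [okw])
    (by simp [sub, pres, pre, mSQ, okw])
  simp only [sub, pres, pre, mSQ, LZ, List.map, List.nil_append, List.cons_append, List.append_nil,
    List.sum_cons, List.sum_nil, add_zero] at h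
  linear_combination -h

end AZ

open Real
namespace AZ
open Lt Filter Topology

set_option maxHeartbeats 4000000 in
lemma final5 :
    2 * Z [a, a, a, a, c] + 2 * Z [a, a, a, a, b] - 4 * Z [a, a, b, a, c] - 4 * Z [a, a, b, a, b]
    - 4 * Z [a, b, a, a, c] - 4 * Z [a, b, a, a, b] + 8 * Z [a, b, b, a, c] + 8 * Z [a, b, b, a,
    b] + 4 * Z [a, a, a, c, c] + 4 * Z [a, a, a, c, b] - 8 * Z [a, a, b, c, c] - 8 * Z [a, a, b,
    c, b] - 8 * Z [a, b, a, c, c] - 8 * Z [a, b, a, c, b] + 16 * Z [a, b, b, c, c] + 16 * Z [a, b,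
    b, c, b] = -(2 / 15) * Real.log 2 ^ 5 + (16 / 3) * Real.log 2 ^ 3 * zetaVal 2 + (4 / 5) *
    Real.log 2 * zetaVal 2 ^ 2 + 3 * zetaVal 2 * zetaVal 3 - (31 / 2) * zetaVal 5 + 16 * I [a, a,
    a, a, c] (1 / 2) := by
  linear_combination
    (1732 / 63) * r5_sh_b_aaab + (724 / 63) * r5_st_b_aaac - (34274 / 819) * r5_st_b_aabc - (66718
    / 819) * r5_sh_b_aabb + (8 / 3) * r5_sh_b_aacb + (1492 / 273) * r5_st_b_abcc + (207023 /
    11466) * r5_sh_ab_aab - 8 * r5_sh_b_abab + (21256 / 819) * r5_st_ab_abb + (20 / 91) *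
    r5_sh_ab_abc + (1472 / 273) * r5_st_b_abbc - (515635 / 11466) * r5_st_ab_aac + (66718 / 819) *
    r5_st_b_aacc + (16 / 273) * r5_sh_b_abcb - (1544 / 273) * r5_sh_b_abcc - (8273 / 273) *
    r5_sh_b_acab + (2713 / 91) * r5_sh_ac_abc - (5312 / 91) * r5_sh_b_aacc + (296 / 273) *
    r5_st_b_abcb + (5312 / 91) * r5_st_b_aabb + (1635761 / 11466) * r5_st_ab_aab - (277 / 91) *
    r5_st_ab_abc - (405 / 91) * r5_sh_ab_acb - (277 / 91) * r5_st_ac_abc + (461827 / 11466) *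
    r5_sh_ab_aac - (6470 / 273) * r5_sh_ac_abb + (12 / 91) * r5_sh_ab_bbb + 16 * r5_half5 -
    (429791 / 11466) * r5_sh_ac_aab - (31 / 2) * r5_def_z + (1903 / 117) * r5_sh_ac_acb + (16 /
    273) * r5_st_b_acbc - (194185 / 3822) * r5_st_ac_aab - (217 / 13) * r5_reg_aaab + (245431 /
    3276) * r5_reg_aaac - (7271 / 819) * r5_st_b_acab - (32090 / 819) * r5_st_b_aacb + (54484 /
    819) * r5_reg_aabb - (13306 / 819) * r5_reg_aabc + (2084 / 273) * r5_reg_abbc + (296 / 273) *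
    r5_sh_b_acbc + (1408 / 273) * r5_reg_abbb + (1492 / 273) * r5_sh_b_acbb - 8 * r5_sh_b_baab +
    (17548 / 819) * r5_sh_b_baac + (4 / 21) * r5_reg_abcb - (764 / 273) * r5_reg_acab + (7292 /
    273) * r5_st_ab_acc + (748 / 21) * r5_sh_ab_abb - (35096 / 819) * r5_sh_bb_aac + (704 / 273) *
    r5_sh_b_babb - (1868 / 273) * r5_reg_acbb + (1472 / 273) * r5_sh_b_accb - (2284 / 273) *
    r5_reg_acbc - (716 / 91) * r5_st_b_accc + (8273 / 273) * r5_sh_ab_bac - (805 / 39) *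
    r5_sh_ac_acc + (5372 / 273) * r5_st_b_abbb - (68 / 273) * r5_st_b_accb - (1544 / 273) *
    r5_st_b_acbb - (68 / 273) * r5_sh_b_abbc + (5372 / 273) * r5_sh_b_accc + (13735 / 546) *
    r5_reg_aacc - (248 / 21) * r5_reg_accb + (42113 / 7644) * r5_sq_aaacc - (34661 / 22932) *
    r5_sq_aacac + (6163 / 234) * r5_sq_aaccc - (216347 / 22932) * r5_sq_acaac + (16987 / 1638) *
    r5_sq_acacc - (76813 / 22932) * r5_sq_aaaac + (1444 / 273) * r5_sh_b_bbab + (1901 / 273) *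
    r5_sq_accac - (8 / 5) * r5_sh_bb_bbb

end AZ

namespace AZ
open Lt

lemma main_sum : LZ (pre 1 Lt.a LS) = -(31 / 2) * zetaVal 5 + 3 * zetaVal 2 * zetaVal 3
    + 16 * polyLog 5 (1 / 2) + 2 * Real.log 2 * zetaVal 4
    + 16 / 3 * Real.log 2 ^ 3 * zetaVal 2 - 2 / 15 * Real.log 2 ^ 5 := by
  have h := final5
  rw [polyLog_half, zetaVal_four]
  simp only [LS, sub, pres, pre, mPHI, LZ, List.map, List.nil_append, List.cons_append,
    List.append_nil, List.sum_cons, List.sum_nil, add_zero]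
  linear_combination h

end AZ

theorem stmt_3 :
    ∑' k : ℕ, (4 : ℝ) ^ (k + 1) * genHarmonic (k + 1) 1 /
      ((k + 1 : ℝ) ^ 4 * (Nat.choose (2 * (k + 1)) (k + 1) : ℝ))
    = -(31 / 2) * zetaVal 5 + 3 * zetaVal 2 * zetaVal 3 + 16 * polyLog 5 (1 / 2)
      + 2 * Real.log 2 * zetaVal 4 + 16 / 3 * Real.log 2 ^ 3 * zetaVal 2 - 2 / 15 * Real.log 2 ^ 5 := by
  rw [AZ.S_word]
  exact AZ.main_sum
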